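/- arXiv:2202.10611 — 7 statements merged into one kernel-verified Lean document; each statement's English description precedes it below -/
import Mathlib

section
/- Fix ε ∈ (0, 2/3). There exists a constant c > 0 such that for all sufficiently large k, all n with k ≤ n^(2/3 − ε), all m, and all d satisfying max(4^(1/(1+ε))·k^1.5/n^(1/(1+ε)), k^(ε−0.5)·√(4 log m)) ≤ d ≤ √(4 log m) and m ≤ c·(k^1.5/d)·log k, the following holds: let v_1, …, v_m be independent random vectors in ℝ^n with i.i.d. standard Gaussian N(0,1) entries, and for a subset U ⊆ {1,…,n} of size k let F_U denote the event that |Σ_{i∈U} (v_j)_i| > d for every j ∈ {1,…,m}. Then for every S ⊆ {1,…,n} with |S| = k, Σ_{T} P[F_S ∩ F_T] ≤ 0.25 · C(n,k) · P[F_S]², where the sum ranges over all T ⊆ {1,…,n} with |T| = k and d·√k ≤ |S ∩ T| ≤ 0.9·k. -/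
open MeasureTheory ProbabilityTheory
open scoped NNReal ENNReal

/-- The sign function: `1` if `0 ≤ z`, `-1` otherwise. -/
noncomputable def sgn (z : ℝ) : ℝ := if 0 ≤ z then 1 else -1

/-- `X_k(R)`: vectors in `ℝ^n` with at most `k` nonzero entries whose nonzero
entries have magnitude ratio at most `R`. -/
def sparseDR (n k : ℕ) (R : ℝ) : Set (Fin n → ℝ) :=
  {x | (Finset.univ.filter fun i => x i ≠ 0).card ≤ k ∧
       ∀ i j : Fin n, x i ≠ 0 → x j ≠ 0 → |x i| ≤ R * |x j|}

/-- `A` is a valid universal 1-bit measurement matrix for support recovery on `X_k(R)`. -/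
def ValidMeas (m n k : ℕ) (R : ℝ) (A : Fin m → Fin n → ℝ) : Prop :=
  ∀ u ∈ sparseDR n k R, ∀ v ∈ sparseDR n k R,
    Function.support u ≠ Function.support v →
      (fun i => sgn (∑ j, A i j * u j)) ≠ (fun i => sgn (∑ j, A i j * v j))

/-- `V ⊆ ℝ^n` is `(n, ℓ, d)`-balanced. -/
def IsBalanced (n ℓ : ℕ) (d : ℝ) (V : Set (Fin n → ℝ)) : Prop :=
  ∀ S : Finset (Fin n), S.card = ℓ → ∃ v ∈ V, |∑ i ∈ S, v i| ≤ d

/-- Law of a random vector in `ℝ^n` with i.i.d. standard Gaussian entries. -/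
noncomputable def gaussVec (n : ℕ) : Measure (Fin n → ℝ) :=
  Measure.pi fun _ => gaussianReal 0 1

/-- Law of `m` independent random vectors in `ℝ^n` with i.i.d. standard Gaussian entries
(equivalently, an `m × n` random matrix with i.i.d. `N(0,1)` entries). -/
noncomputable def gaussMat (m n : ℕ) : Measure (Fin m → Fin n → ℝ) :=
  Measure.pi fun _ => gaussVec n

/-- The event `F_U`: every one of the `m` vectors `v j` satisfies `|∑_{i ∈ U} (v j) i| > d`. -/
def FEvent (m n : ℕ) (d : ℝ) (U : Finset (Fin n)) : Set (Fin m → Fin n → ℝ) :=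
  {v | ∀ j : Fin m, d < |∑ i ∈ U, v j i|}

open Real

lemma iIndepFun_eval_gaussVec (n : ℕ) :
    iIndepFun (fun (i : Fin n) (x : Fin n → ℝ) ↦ x i) (gaussVec n) :=
  iIndepFun_pi (X := fun _ ↦ id) fun _ ↦ aemeasurable_id

instance isGaussian_gaussVec (n : ℕ) : IsGaussian (gaussVec n) := by
  have h : HasGaussianLaw (fun (x : Fin n → ℝ) ↦ (x ·)) (gaussVec n) := by
    refine iIndepFun.hasGaussianLaw (fun i ↦ ⟨?_⟩) (iIndepFun_eval_gaussVec n)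
    rw [gaussVec, (measurePreserving_eval (fun _ : Fin n ↦ gaussianReal 0 1) i).map_eq]
    infer_instance
  have := h.isGaussian_map
  rwa [Measure.map_id'] at this

/-- Distinct coordinates are uncorrelated with unit variance. -/
lemma covariance_eval_gaussVec (n : ℕ) (i j : Fin n) :
    cov[fun x ↦ x i, fun x ↦ x j; gaussVec n] = if i = j then 1 else 0 := by
  have hmem (i : Fin n) : MemLp (fun x : Fin n → ℝ ↦ x i) 2 (gaussVec n) :=
    IsGaussian.memLp_dual (gaussVec n) (ContinuousLinearMap.proj i) 2 (by simp)
  split_ifs with h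
  · subst h
    rw [covariance_self (Measurable.aemeasurable (by fun_prop))]
    have := (measurePreserving_eval (fun _ : Fin n ↦ gaussianReal 0 1) i).variance_fun_comp
      (f := id) (by fun_prop)
    simpa [gaussVec] using this
  · exact ((iIndepFun_eval_gaussVec n).indepFun h).covariance_eq_zero (hmem i) (hmem j)

lemma covariance_linear_gaussVec {n : ℕ} (a b : Fin n → ℝ) :
    cov[fun x ↦ ∑ i, a i * x i, fun x ↦ ∑ i, b i * x i; gaussVec n] = ∑ i, a i * b i := by
  have hmem (a : Fin n → ℝ) (i : Fin n) :
      MemLp (fun x : Fin n → ℝ ↦ a i * x i) 2 (gaussVec n) :=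
    (IsGaussian.memLp_dual (gaussVec n) (ContinuousLinearMap.proj i) 2 (by simp)).const_mul _
  rw [covariance_fun_sum_fun_sum (hmem a) (hmem b)]
  simp_rw [covariance_const_mul_left, covariance_const_mul_right, covariance_eval_gaussVec]
  simp

lemma map_linear_gaussVec {n : ℕ} (a : Fin n → ℝ) :
    (gaussVec n).map (fun x ↦ ∑ i, a i * x i) = gaussianReal 0 (∑ i, a i ^ 2).toNNReal := by
  have h := IsGaussian.map_eq_gaussianReal (μ := gaussVec n)
    (∑ i, a i • ContinuousLinearMap.proj (R := ℝ) (φ := fun _ : Fin n ↦ ℝ) i)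
  have h1 : ⇑(∑ i, a i • ContinuousLinearMap.proj (R := ℝ) (φ := fun _ : Fin n ↦ ℝ) i)
      = fun x : Fin n → ℝ ↦ ∑ i, a i * x i := by
    ext x; simp
  have h2 : ∫ x, ∑ i, a i * x i ∂gaussVec n = 0 := by
    rw [integral_finsetSum]
    · refine Finset.sum_eq_zero fun i _ ↦ ?_
      rw [integral_const_mul]
      have := integral_comp_eval (μ := fun _ : Fin n ↦ gaussianReal 0 1) (i := i) (f := id)
        (by fun_prop)
      simp only [id, integral_id_gaussianReal] at this
      rw [gaussVec, this, mul_zero]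
    · intro i _
      exact (IsGaussian.integrable_dual (gaussVec n) (ContinuousLinearMap.proj i)).const_mul _
  rw [h1, h2, ← covariance_self (Measurable.aemeasurable (by fun_prop)),
    covariance_linear_gaussVec] at h
  simpa [sq] using h

lemma indepFun_linear_gaussVec {n : ℕ} {a b : Fin n → ℝ} (hab : ∑ i, a i * b i = 0) :
    IndepFun (fun x ↦ ∑ i, a i * x i) (fun x ↦ ∑ i, b i * x i) (gaussVec n) := by
  refine HasGaussianLaw.indepFun_of_covariance_eq_zero ⟨?_⟩
    ((covariance_linear_gaussVec a b).trans hab)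
  let L (a : Fin n → ℝ) : (Fin n → ℝ) →L[ℝ] ℝ :=
    ∑ i, a i • ContinuousLinearMap.proj (R := ℝ) (φ := fun _ : Fin n ↦ ℝ) i
  have h : ⇑((L a).prod (L b)) = fun x : Fin n → ℝ ↦ (∑ i, a i * x i, ∑ i, b i * x i) := by
    ext x <;> simp [L]
  exact h ▸ isGaussian_map ((L a).prod (L b))

lemma gaussianPDFReal_zero_le (v : ℝ≥0) (x : ℝ) : gaussianPDFReal 0 v x ≤ (√(2 * π * v))⁻¹ := by
  rw [gaussianPDFReal]
  refine mul_le_of_le_one_right (by positivity) (exp_le_one_iff.2 ?_)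
  rw [neg_div]
  exact neg_nonpos.2 (by positivity)

lemma gaussianReal_Icc_le {v : ℝ≥0} (hv : v ≠ 0) {a b : ℝ} (hab : a ≤ b) :
    (gaussianReal 0 v).real (Set.Icc a b) ≤ (b - a) * (√(2 * π * v))⁻¹ := by
  rw [measureReal_def, gaussianReal_apply_eq_integral _ hv, ENNReal.toReal_ofReal
    (integral_nonneg fun x ↦ gaussianPDFReal_nonneg _ _ _)]
  calc _ ≤ ∫ _ in Set.Icc a b, (√(2 * π * v))⁻¹ :=
        setIntegral_mono (integrable_gaussianPDFReal 0 v).integrableOn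
          (integrableOn_const (by simp)) (gaussianPDFReal_zero_le v)
    _ = _ := by simp [hab]

lemma le_gaussianReal_Icc {v : ℝ≥0} (hv : v ≠ 0) {d : ℝ} (hd : 0 ≤ d) :
    2 * d * (√(2 * π * v))⁻¹ * exp (-d ^ 2 / (2 * v)) ≤
      (gaussianReal 0 v).real (Set.Icc (-d) d) := by
  rw [measureReal_def, gaussianReal_apply_eq_integral _ hv, ENNReal.toReal_ofReal
    (integral_nonneg fun x ↦ gaussianPDFReal_nonneg _ _ _)]
  calc _ = ∫ _ in Set.Icc (-d) d, (√(2 * π * v))⁻¹ * exp (-d ^ 2 / (2 * v)) := by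
        rw [setIntegral_const, Real.volume_real_Icc_of_le (by linarith), smul_eq_mul]; ring
    _ ≤ _ := by
        refine setIntegral_mono_on (integrableOn_const (by simp))
          (integrable_gaussianPDFReal 0 v).integrableOn measurableSet_Icc fun x hx ↦ ?_
        rw [gaussianPDFReal, sub_zero]
        have : x ^ 2 ≤ d ^ 2 := sq_le_sq' hx.1 hx.2
        gcongr

/-- For uncorrelated linear forms `X`, `W`, the event `|X| ≤ d`, `|r X + W| ≤ d` has probability
at most `P(|X| ≤ d)` times the maximal mass that `W` gives to an interval of length `2d`. -/
lemma gaussVec_real_abs_le_and_le {n : ℕ} {a b : Fin n → ℝ} (hab : ∑ i, a i * b i = 0)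
    (hb : 0 < ∑ i, b i ^ 2) (r : ℝ) {d : ℝ} (hd : 0 ≤ d) :
    (gaussVec n).real {x | |∑ i, a i * x i| ≤ d ∧ |r * ∑ i, a i * x i + ∑ i, b i * x i| ≤ d} ≤
      (gaussVec n).real {x | |∑ i, a i * x i| ≤ d} * (2 * d * (√(2 * π * ∑ i, b i ^ 2))⁻¹) := by
  set X := fun x : Fin n → ℝ ↦ ∑ i, a i * x i
  set W := fun x : Fin n → ℝ ↦ ∑ i, b i * x i
  set v := (∑ i, b i ^ 2).toNNReal with hv
  have hv0 : v ≠ 0 := by simpa [hv] using hb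
  have hvc : (v : ℝ) = ∑ i, b i ^ 2 := Real.coe_toNNReal _ hb.le
  have hmX : Measurable X := by fun_prop
  have hmW : Measurable W := by fun_prop
  have hmap := (indepFun_iff_map_prod_eq_prod_map_map hmX.aemeasurable hmW.aemeasurable).1
    (indepFun_linear_gaussVec hab)
  have hWlaw : (gaussVec n).map W = gaussianReal 0 v := map_linear_gaussVec b
  set A : Set (ℝ × ℝ) := {z | |z.1| ≤ d ∧ |r * z.1 + z.2| ≤ d} with hA
  have hmA : MeasurableSet A := by
    exact (measurableSet_le (f := fun z : ℝ × ℝ ↦ |z.1|) (by fun_prop) measurable_const).inter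
      (measurableSet_le (f := fun z : ℝ × ℝ ↦ |r * z.1 + z.2|) (by fun_prop) measurable_const)
  have hmI : MeasurableSet {z : ℝ | |z| ≤ d} := measurableSet_le (by fun_prop) (by fun_prop)
  set B : ℝ≥0∞ := ENNReal.ofReal (2 * d * (√(2 * π * v))⁻¹) with hB
  have key : gaussVec n {x | |X x| ≤ d ∧ |r * X x + W x| ≤ d} ≤ gaussVec n {x | |X x| ≤ d} * B := by
    have h1 : gaussVec n {x | |X x| ≤ d ∧ |r * X x + W x| ≤ d}
        = ((gaussVec n).map X).prod (gaussianReal 0 v) A := by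
      rw [← hWlaw, ← hmap, Measure.map_apply (by fun_prop) hmA]
      rfl
    have h2 : gaussVec n {x | |X x| ≤ d} = (gaussVec n).map X {z | |z| ≤ d} := by
      rw [Measure.map_apply hmX hmI]; rfl
    have : IsProbabilityMeasure ((gaussVec n).map X) :=
      Measure.isProbabilityMeasure_map hmX.aemeasurable
    rw [h1, h2, Measure.prod_apply hmA, mul_comm, ← lintegral_indicator_const hmI]
    refine lintegral_mono fun z ↦ ?_
    by_cases hz : |z| ≤ d
    · rw [Set.indicator_of_mem (by exact hz)]
      calc _ ≤ gaussianReal 0 v (Set.Icc (-d - r * z) (d - r * z)) := by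
            refine measure_mono fun w hw ↦ ?_
            have := abs_le.1 hw.2
            constructor <;> linarith
        _ ≤ B := by
            rw [hB, ENNReal.le_ofReal_iff_toReal_le (measure_ne_top _ _) (by positivity)]
            refine (gaussianReal_Icc_le hv0 (by linarith)).trans (le_of_eq ?_)
            ring
    · have : Prod.mk z ⁻¹' A = ∅ := by
        ext w; simp [hA, hz]
      simp [this]
  rw [← hvc]
  have := ENNReal.toReal_mono (by finiteness) key
  rwa [ENNReal.toReal_mul, hB, ENNReal.toReal_ofReal (by positivity)] at this

lemma map_sum_gaussVec {n : ℕ} (U : Finset (Fin n)) :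
    (gaussVec n).map (fun x ↦ ∑ i ∈ U, x i) = gaussianReal 0 U.card := by
  have h := map_linear_gaussVec (fun i ↦ if i ∈ U then (1 : ℝ) else 0)
  simpa [ite_pow] using h

lemma gaussVec_real_abs_sum_le {n : ℕ} (U : Finset (Fin n)) (d : ℝ) :
    (gaussVec n).real {x | |∑ i ∈ U, x i| ≤ d} =
      (gaussianReal 0 U.card).real (Set.Icc (-d) d) := by
  rw [← map_sum_gaussVec U, map_measureReal_apply (by fun_prop) measurableSet_Icc]
  congr 1
  ext x
  simp [abs_le]

lemma gaussVec_real_abs_sum_le_and_le {n k : ℕ} (hk : 0 < k) {S T : Finset (Fin n)}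
    (hS : S.card = k) (hT : T.card = k) {ρ : ℝ} (hρ : ((S ∩ T).card : ℝ) = ρ * k)
    (hρ1 : ρ ^ 2 < 1) {d : ℝ} (hd : 0 ≤ d) :
    (gaussVec n).real {x | |∑ i ∈ S, x i| ≤ d ∧ |∑ i ∈ T, x i| ≤ d} ≤
      (gaussVec n).real {x | |∑ i ∈ S, x i| ≤ d} *
        (2 * d * (√(2 * π * (k * (1 - ρ ^ 2))))⁻¹) := by
  set a : Fin n → ℝ := fun i ↦ if i ∈ S then 1 else 0
  set t : Fin n → ℝ := fun i ↦ if i ∈ T then 1 else 0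
  set b : Fin n → ℝ := fun i ↦ t i - ρ * a i
  have haa : ∑ i, a i * a i = k := by simp [a, hS]
  have htt : ∑ i, t i * t i = k := by simp [t, hT]
  have hat : ∑ i, a i * t i = ρ * k := by
    rw [← hρ]
    simp [a, t, Finset.inter_comm]
  have hab : ∑ i, a i * b i = 0 := by
    calc ∑ i, a i * b i = ∑ i, a i * t i - ρ * ∑ i, a i * a i := by
          rw [Finset.mul_sum, ← Finset.sum_sub_distrib]
          exact Finset.sum_congr rfl fun i _ ↦ by simp only [b]; ring
      _ = 0 := by rw [haa, hat]; ring
  have hbb : ∑ i, b i ^ 2 = k * (1 - ρ ^ 2) := by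
    calc ∑ i, b i ^ 2 = ∑ i, t i * t i - 2 * ρ * ∑ i, a i * t i + ρ ^ 2 * ∑ i, a i * a i := by
          rw [Finset.mul_sum, Finset.mul_sum, ← Finset.sum_sub_distrib, ← Finset.sum_add_distrib]
          exact Finset.sum_congr rfl fun i _ ↦ by simp only [b]; ring
      _ = _ := by rw [haa, hat, htt]; ring
  have hpos : 0 < ∑ i, b i ^ 2 := by
    rw [hbb]
    exact mul_pos (by exact_mod_cast hk) (by linarith)
  have h := gaussVec_real_abs_le_and_le hab hpos ρ hd
  have hSx (x : Fin n → ℝ) : ∑ i, a i * x i = ∑ i ∈ S, x i := by simp [a]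
  have hTx (x : Fin n → ℝ) : ρ * ∑ i ∈ S, x i + ∑ i, b i * x i = ∑ i ∈ T, x i := by
    have : ∑ i, t i * x i = ∑ i ∈ T, x i := by simp [t]
    rw [← hSx, ← this, Finset.mul_sum, ← Finset.sum_add_distrib]
    exact Finset.sum_congr rfl fun i _ ↦ by simp only [b]; ring
  simpa only [hSx, hTx, hbb] using h

/-- Inclusion-exclusion for the complements of two events. -/
lemma probReal_compl_inter_compl {Ω : Type*} [MeasurableSpace Ω] (μ : Measure Ω)
    [IsProbabilityMeasure μ] {A B : Set Ω} (hA : MeasurableSet A) (hB : MeasurableSet B) :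
    μ.real (Aᶜ ∩ Bᶜ) = 1 - μ.real A - μ.real B + μ.real (A ∩ B) := by
  rw [← Set.compl_union, probReal_compl_eq_one_sub (hA.union hB)]
  linarith [measureReal_union_add_inter (μ := μ) (s := A) hB]

lemma one_sub_two_mul_add_le {p β δ ρ J : ℝ} (hp0 : 0 ≤ p) (hpδ : p ≤ δ) (hδ : δ ≤ 1 / 2)
    (hδρ : δ ≤ ρ) (hρ : ρ ≤ 0.9) (hβ0 : 0 ≤ β) (hβ : β * exp (-δ ^ 2 / 2) ≤ p)
    (hJ : J ≤ p * (β * (√(1 - ρ ^ 2))⁻¹)) :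
    1 - p - p + J ≤ (1 - p) ^ 2 * (1 + 48 * (δ ^ 2 * ρ ^ 2)) := by
  have hδ0 : 0 ≤ δ := hp0.trans hpδ
  have hρ0 : 0 ≤ ρ := hδ0.trans hδρ
  have hρ2 : ρ ^ 2 ≤ 0.81 := by nlinarith
  have hδ2 : δ ^ 2 ≤ ρ ^ 2 := by gcongr
  have hδ3 : δ ^ 2 ≤ 1 / 4 := by nlinarith
  have hexp : 1 - δ ^ 2 / 2 ≤ exp (-δ ^ 2 / 2) := by
    linarith [add_one_le_exp (-δ ^ 2 / 2)]
  have hβp : β ≤ p * (1 + δ ^ 2) := by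
    have h1 : β * (1 - δ ^ 2 / 2) ≤ p := (mul_le_mul_of_nonneg_left hexp hβ0).trans hβ
    have h2 : 1 ≤ (1 - δ ^ 2 / 2) * (1 + δ ^ 2) := by nlinarith [sq_nonneg δ]
    calc β ≤ β * ((1 - δ ^ 2 / 2) * (1 + δ ^ 2)) := le_mul_of_one_le_right hβ0 h2
      _ = β * (1 - δ ^ 2 / 2) * (1 + δ ^ 2) := by ring
      _ ≤ _ := by gcongr
  have hsqrt : (√(1 - ρ ^ 2))⁻¹ ≤ (1 - ρ ^ 2)⁻¹ := by
    apply inv_anti₀ (by linarith)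
    apply Real.le_sqrt_of_sq_le
    nlinarith [sq_nonneg ρ]
  have hfac : (1 + δ ^ 2) * (1 - ρ ^ 2)⁻¹ ≤ 1 + 12 * ρ ^ 2 := by
    rw [← div_eq_mul_inv, div_le_iff₀ (by linarith)]
    nlinarith [sq_nonneg ρ]
  have hJ2 : J ≤ p ^ 2 * (1 + 12 * ρ ^ 2) := by
    calc J ≤ p * (β * (√(1 - ρ ^ 2))⁻¹) := hJ
      _ ≤ p * (p * (1 + δ ^ 2) * (1 - ρ ^ 2)⁻¹) := by gcongr
      _ = p ^ 2 * ((1 + δ ^ 2) * (1 - ρ ^ 2)⁻¹) := by ring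
      _ ≤ _ := by gcongr
  have hq : 1 / 4 ≤ (1 - p) ^ 2 := by nlinarith
  have hpp : p ^ 2 * ρ ^ 2 ≤ δ ^ 2 * ρ ^ 2 := by gcongr
  have hmul : 1 / 4 * (48 * (δ ^ 2 * ρ ^ 2)) ≤ (1 - p) ^ 2 * (48 * (δ ^ 2 * ρ ^ 2)) := by gcongr
  linarith

/-- One row: the joint probability is at most the square of the marginal one, up to a factor
`1 + O((d²/k) (|S ∩ T|/k)²)`. -/
lemma gaussVec_real_lt_abs_sum_and_lt_le {n k : ℕ} (hk : 0 < k) {S T : Finset (Fin n)}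
    (hS : S.card = k) (hT : T.card = k) {ρ δ d : ℝ} (hρ : ((S ∩ T).card : ℝ) = ρ * k)
    (hd : 0 ≤ d) (hδ : d = δ * √k) (hδ1 : δ ≤ 1 / 2) (hδρ : δ ≤ ρ) (hρ1 : ρ ≤ 0.9) :
    (gaussVec n).real {x | d < |∑ i ∈ S, x i| ∧ d < |∑ i ∈ T, x i|} ≤
      (gaussVec n).real {x | d < |∑ i ∈ S, x i|} ^ 2 * (1 + 48 * (δ ^ 2 * ρ ^ 2)) := by
  have hk' : (0 : ℝ) < k := by exact_mod_cast hk
  have hsk : 0 < √(k : ℝ) := Real.sqrt_pos.2 hk'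
  have hδ0 : 0 ≤ δ := by
    by_contra! h
    nlinarith
  have hρ0 : 0 ≤ ρ := hδ0.trans hδρ
  have hm (U : Finset (Fin n)) : MeasurableSet {x : Fin n → ℝ | |∑ i ∈ U, x i| ≤ d} :=
    measurableSet_le (f := fun x : Fin n → ℝ ↦ |∑ i ∈ U, x i|) (by fun_prop) measurable_const
  have hc (U : Finset (Fin n)) :
      {x : Fin n → ℝ | d < |∑ i ∈ U, x i|} = {x : Fin n → ℝ | |∑ i ∈ U, x i| ≤ d}ᶜ := by
    ext x; simp
  rw [Set.ofPred_and, hc, hc, probReal_compl_inter_compl _ (hm S) (hm T),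
    probReal_compl_eq_one_sub (hm S)]
  have hST : (gaussVec n).real {x | |∑ i ∈ T, x i| ≤ d} =
      (gaussVec n).real {x | |∑ i ∈ S, x i| ≤ d} := by
    rw [gaussVec_real_abs_sum_le, gaussVec_real_abs_sum_le, hS, hT]
  rw [hST]
  have hkn : ((k : ℕ) : ℝ≥0) ≠ 0 := by exact_mod_cast hk.ne'
  have hp := gaussVec_real_abs_sum_le S d
  rw [hS] at hp
  have hle := gaussianReal_Icc_le hkn (show -d ≤ d by linarith)
  have hge := le_gaussianReal_Icc hkn hd
  rw [← hp] at hle hge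
  simp only [NNReal.coe_natCast] at hle hge
  have hsplit : √(2 * π * k) = √(2 * π) * √k := Real.sqrt_mul (by positivity) _
  refine one_sub_two_mul_add_le (β := 2 * d * (√(2 * π * k))⁻¹) measureReal_nonneg ?_ hδ1 hδρ hρ1
    (by positivity) ?_ ?_
  · refine hle.trans ?_
    have h2 : 2 ≤ √(2 * π) := Real.le_sqrt_of_sq_le (by nlinarith [pi_gt_three])
    rw [← div_eq_mul_inv, div_le_iff₀ (by positivity), hsplit, hδ]
    nlinarith [mul_nonneg hδ0 hsk.le]
  · convert hge using 3
    rw [hδ, mul_pow, Real.sq_sqrt hk'.le]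
    field_simp
  · have h := gaussVec_real_abs_sum_le_and_le hk hS hT hρ (by nlinarith) hd
    rw [Set.ofPred_and] at h
    convert h using 2
    rw [← mul_assoc (2 * π), Real.sqrt_mul (by positivity) (1 - ρ ^ 2), mul_inv, mul_assoc]

lemma gaussMat_setOf_forall_mem {m n : ℕ} (A : Set (Fin n → ℝ)) :
    gaussMat m n {v | ∀ j, v j ∈ A} = gaussVec n A ^ m := by
  have h : {v : Fin m → Fin n → ℝ | ∀ j, v j ∈ A} = Set.univ.pi fun _ ↦ A := by
    ext v; simp
  rw [h, gaussMat, Measure.pi_pi]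
  simp

/-- The correlation bound for the whole matrix. -/
lemma gaussMat_FEvent_inter_le {m n k : ℕ} (hk : 0 < k) {S T : Finset (Fin n)}
    (hS : S.card = k) (hT : T.card = k) {ρ δ d : ℝ} (hρ : ((S ∩ T).card : ℝ) = ρ * k)
    (hd : 0 ≤ d) (hδ : d = δ * √k) (hδ1 : δ ≤ 1 / 2) (hδρ : δ ≤ ρ) (hρ1 : ρ ≤ 0.9) :
    gaussMat m n (FEvent m n d S ∩ FEvent m n d T) ≤
      ENNReal.ofReal (exp (48 * (δ ^ 2 * ρ ^ 2) * m)) * gaussMat m n (FEvent m n d S) ^ 2 := by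
  have h1 : FEvent m n d S ∩ FEvent m n d T =
      {v | ∀ j, v j ∈ {x : Fin n → ℝ | d < |∑ i ∈ S, x i| ∧ d < |∑ i ∈ T, x i|}} := by
    ext v; simp [FEvent, forall_and]
  have h2 : FEvent m n d S = {v | ∀ j, v j ∈ {x : Fin n → ℝ | d < |∑ i ∈ S, x i|}} := rfl
  have h := gaussVec_real_lt_abs_sum_and_lt_le hk hS hT hρ hd hδ hδ1 hδρ hρ1
  rw [h1, h2, gaussMat_setOf_forall_mem, gaussMat_setOf_forall_mem]
  set P := gaussVec n {x : Fin n → ℝ | d < |∑ i ∈ S, x i|}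
  have hle : gaussVec n {x : Fin n → ℝ | d < |∑ i ∈ S, x i| ∧ d < |∑ i ∈ T, x i|} ≤
      ENNReal.ofReal (exp (48 * (δ ^ 2 * ρ ^ 2))) * P ^ 2 := by
    rw [← ENNReal.toReal_le_toReal (by finiteness) (by finiteness), ENNReal.toReal_mul,
      ENNReal.toReal_pow, ENNReal.toReal_ofReal (exp_nonneg _)]
    refine h.trans ?_
    rw [mul_comm]
    gcongr
    · linarith [add_one_le_exp (48 * (δ ^ 2 * ρ ^ 2))]
    · exact le_rfl
  calc _ ≤ (ENNReal.ofReal (exp (48 * (δ ^ 2 * ρ ^ 2))) * P ^ 2) ^ m := by gcongr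
    _ = _ := by
      rw [mul_pow, ← ENNReal.ofReal_pow (exp_nonneg _), ← exp_nat_mul, ← pow_mul, ← pow_mul,
        mul_comm (m : ℝ), mul_comm 2 m]

lemma choose_sub_mul_pow_le {n k a : ℕ} (hkn : k ≤ n) (hak : a ≤ k) :
    (n - a).choose (k - a) * n ^ a ≤ n.choose k * k ^ a := by
  induction a with
  | zero => simp
  | succ a ih =>
    obtain ⟨k', rfl⟩ := Nat.exists_eq_add_of_le hak
    obtain ⟨n', rfl⟩ := Nat.exists_eq_add_of_le hkn
    have e1 : a + 1 + k' + n' - (a + 1) = k' + n' := by omega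
    have e2 : a + 1 + k' - (a + 1) = k' := by omega
    have e3 : a + 1 + k' + n' - a = k' + n' + 1 := by omega
    have e4 : a + 1 + k' - a = k' + 1 := by omega
    have ih' := ih (by omega)
    rw [e3, e4] at ih'
    rw [e1, e2]
    have hc := Nat.add_one_mul_choose_eq (k' + n') k'
    have hfrac : (k' + 1) * (a + 1 + k' + n') ≤ (a + 1 + k') * (k' + n' + 1) := by nlinarith
    refine Nat.le_of_mul_le_mul_left ?_ (show 0 < k' + n' + 1 by omega)
    calc (k' + n' + 1) * ((k' + n').choose k' * (a + 1 + k' + n') ^ (a + 1))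
        = ((k' + n' + 1) * (k' + n').choose k') * (a + 1 + k' + n') ^ (a + 1) := by ring
      _ = ((k' + n' + 1).choose (k' + 1) * (a + 1 + k' + n') ^ a) *
            ((k' + 1) * (a + 1 + k' + n')) := by rw [hc]; ring
      _ ≤ ((a + 1 + k' + n').choose (a + 1 + k') * (a + 1 + k') ^ a) *
            ((a + 1 + k') * (k' + n' + 1)) := Nat.mul_le_mul ih' hfrac
      _ = _ := by ring

/-- Moment generating function bound for the overlap of a fixed `k`-set with a random one. -/
lemma sum_powersetCard_one_add_pow_le {n k : ℕ} {S : Finset (Fin n)} (hS : S.card = k) {t : ℝ}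
    (ht : 0 ≤ t) :
    ∑ T ∈ (Finset.univ : Finset (Fin n)).powersetCard k, (1 + t) ^ (S ∩ T).card ≤
      n.choose k * exp (t * k ^ 2 / n) := by
  have hkn : k ≤ n := by simpa [hS] using Finset.card_le_univ S
  rcases Nat.eq_zero_or_pos n with rfl | hn
  · obtain rfl : k = 0 := by omega
    simp
  have hn' : (0 : ℝ) < n := by exact_mod_cast hn
  have hexpand (T : Finset (Fin n)) : (1 + t) ^ (S ∩ T).card =
      ∑ A ∈ S.powerset, if A ⊆ T then t ^ A.card else 0 := by
    rw [← Finset.sum_filter, add_comm, ← Finset.sum_pow_mul_eq_add_pow]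
    simp only [one_pow, mul_one]
    refine Finset.sum_congr ?_ fun _ _ ↦ rfl
    ext A
    rw [Finset.mem_filter, Finset.mem_powerset, Finset.mem_powerset, Finset.subset_inter_iff]
  simp_rw [hexpand]
  rw [Finset.sum_comm]
  calc ∑ A ∈ S.powerset, ∑ T ∈ (Finset.univ : Finset (Fin n)).powersetCard k,
        (if A ⊆ T then t ^ A.card else 0)
      ≤ ∑ A ∈ S.powerset, n.choose k * (t * k / n) ^ A.card := by
        refine Finset.sum_le_sum fun A hA ↦ ?_
        have hAk : A.card ≤ k := hS ▸ Finset.card_le_card (Finset.mem_powerset.1 hA)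
        rw [← Finset.sum_filter, Finset.sum_const,
          Finset.card_filter_powersetCard_subset _ _ _ (Finset.subset_univ _) hAk, nsmul_eq_mul,
          Finset.card_univ, Fintype.card_fin]
        have h : ((n - A.card).choose (k - A.card) : ℝ) * (n : ℝ) ^ A.card ≤
            n.choose k * (k : ℝ) ^ A.card := by exact_mod_cast choose_sub_mul_pow_le hkn hAk
        rw [div_pow, mul_pow, mul_div_assoc', le_div_iff₀ (by positivity)]
        calc _ = ((n - A.card).choose (k - A.card) : ℝ) * (n : ℝ) ^ A.card * t ^ A.card := by ring
          _ ≤ n.choose k * (k : ℝ) ^ A.card * t ^ A.card := by gcongr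
          _ = _ := by ring
    _ = n.choose k * (1 + t * k / n) ^ k := by
        rw [← Finset.mul_sum, add_comm, ← hS, ← Finset.sum_pow_mul_eq_add_pow]
        simp
    _ ≤ n.choose k * exp (t * k ^ 2 / n) := by
        gcongr
        calc (1 + t * k / n) ^ k ≤ exp (t * k / n) ^ k := by
              gcongr
              linarith [add_one_le_exp (t * k / n)]
          _ = _ := by rw [← exp_nat_mul]; congr 1; ring

/-- Chernoff bound for the upper tail of the overlap, weighted by `exp |S ∩ T|`. -/
lemma sum_exp_card_inter_le {n k : ℕ} {S : Finset (Fin n)} (hS : S.card = k) {L : ℝ}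
    (hL : exp 4 * k ^ 2 / n ≤ L) (hL1 : 1 ≤ L) (p : Finset (Fin n) → Prop) [DecidablePred p]
    (hp : ∀ T, p T → L ≤ (S ∩ T).card) :
    ∑ T ∈ ((Finset.univ : Finset (Fin n)).powersetCard k).filter p, exp (S ∩ T).card ≤
      1 / 4 * n.choose k := by
  calc _ ≤ ∑ T ∈ ((Finset.univ : Finset (Fin n)).powersetCard k).filter p,
          exp (-3 * L) * (1 + (exp 4 - 1)) ^ (S ∩ T).card := by
        refine Finset.sum_le_sum fun T hT ↦ ?_
        have := hp T (Finset.mem_filter.1 hT).2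
        rw [add_sub_cancel, ← exp_nat_mul, ← exp_add]
        gcongr
        linarith
    _ ≤ ∑ T ∈ (Finset.univ : Finset (Fin n)).powersetCard k,
          exp (-3 * L) * (1 + (exp 4 - 1)) ^ (S ∩ T).card := by
        refine Finset.sum_le_sum_of_subset_of_nonneg (Finset.filter_subset _ _) fun T _ _ ↦ ?_
        rw [add_sub_cancel]
        positivity
    _ ≤ exp (-3 * L) * (n.choose k * exp ((exp 4 - 1) * k ^ 2 / n)) := by
        rw [← Finset.mul_sum]
        gcongr
        exact sum_powersetCard_one_add_pow_le hS (by linarith [add_one_le_exp (4 : ℝ)])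
    _ ≤ exp (-3 * L) * (n.choose k * exp L) := by
        gcongr
        refine le_trans ?_ hL
        gcongr
        linarith
    _ = exp (-2 * L) * n.choose k := by
        rw [mul_left_comm, ← exp_add, mul_comm]
        congr 2
        ring
    _ ≤ 1 / 4 * n.choose k := by
        gcongr
        have h4 : (4 : ℝ) ≤ exp 2 := by
          rw [show (2 : ℝ) = 1 + 1 by norm_num, exp_add]
          nlinarith [exp_one_gt_d9]
        calc exp (-2 * L) ≤ exp (-2) := by gcongr; linarith
          _ = (exp 2)⁻¹ := exp_neg 2
          _ ≤ 1 / 4 := by rw [one_div]; exact inv_anti₀ (by norm_num) h4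

lemma eventually_log_bounds {ε : ℝ} (hε : 0 < ε) :
    ∀ᶠ k : ℕ in Filter.atTop,
      1 ≤ log k ∧ 27648 * log k ^ 3 ≤ k ∧ exp 4 ≤ 4 * (k : ℝ) ^ ε := by
  have hcast := tendsto_natCast_atTop_atTop (R := ℝ)
  have h1 := (tendsto_log_atTop.comp hcast).eventually_ge_atTop 1
  have h2 := hcast.eventually
    ((isLittleO_pow_log_id_atTop (n := 3)).bound (show (0 : ℝ) < 1 / 27648 by norm_num))
  have h3 := ((tendsto_rpow_atTop hε).comp hcast).eventually_ge_atTop (exp 4 / 4)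
  filter_upwards [h1, h2, h3] with k h1 h2 h3
  simp only [Function.comp_apply] at h1 h3
  refine ⟨h1, ?_, by linarith⟩
  simp only [id, norm_eq_abs, Nat.abs_cast] at h2
  linarith [le_abs_self (log k ^ 3)]

/-- If `d ≥ k ^ (ε - 1/2)` and `m ≤ (k ^ 1.5 / d) log k`, then `m ≤ k ^ 3`. -/
lemma log_le_three_mul_log {k m : ℕ} {ε d : ℝ} (hε : 0 < ε) (hk : (1 : ℝ) ≤ k) (hm : 0 < m)
    (hd : (k : ℝ) ^ (ε - 0.5) ≤ d)
    (hmk : (m : ℝ) ≤ (k : ℝ) ^ (1.5 : ℝ) / d * log k) : log m ≤ 3 * log k := by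
  have hk0 : (0 : ℝ) < k := by linarith
  have hle : (m : ℝ) ≤ (k : ℝ) ^ 3 := by
    calc (m : ℝ) ≤ (k : ℝ) ^ (1.5 : ℝ) / d * log k := hmk
      _ ≤ (k : ℝ) ^ (1.5 : ℝ) / (k : ℝ) ^ (ε - 0.5) * k := by
          gcongr
          linarith [log_le_sub_one_of_pos hk0]
      _ = (k : ℝ) ^ (2 - ε) * k := by
          rw [← rpow_sub hk0]
          norm_num
          left
          congr 1
          ring
      _ ≤ (k : ℝ) ^ (2 : ℝ) * k := by
          gcongr
          linarith
      _ = (k : ℝ) ^ 3 := by rw [rpow_two]; ring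
  have := log_le_log (by exact_mod_cast hm) hle
  rwa [log_pow] at this

/-- The mean overlap `k² / n` is small compared with `d √k`. -/
lemma exp_four_mul_sq_div_le {k n : ℕ} {ε d : ℝ} (hε : 0 < ε) (hk : (0 : ℝ) < k) (hn : (0 : ℝ) < n)
    (hdk : d ≤ √k) (hkε : exp 4 ≤ 4 * (k : ℝ) ^ ε)
    (hd : (4 : ℝ) ^ (1 / (1 + ε)) * (k : ℝ) ^ (1.5 : ℝ) / (n : ℝ) ^ (1 / (1 + ε)) ≤ d) :
    exp 4 * (k : ℝ) ^ 2 / n ≤ d * √k := by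
  have hd0 : 0 < d := lt_of_lt_of_le (by positivity) hd
  have hpow : 4 * (k : ℝ) ^ (1.5 * (1 + ε)) / n ≤ d ^ (1 + ε) := by
    have h := rpow_le_rpow (by positivity) hd (show 0 ≤ 1 + ε by linarith)
    rwa [div_rpow (by positivity) (by positivity), mul_rpow (by positivity) (by positivity),
      ← rpow_mul (by norm_num), ← rpow_mul hn.le, ← rpow_mul hk.le,
      one_div_mul_cancel (by linarith), rpow_one, rpow_one] at h
  have hdε : d ^ (1 + ε) ≤ d * (k : ℝ) ^ (ε / 2) := by
    rw [rpow_add hd0, rpow_one]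
    gcongr
    calc d ^ ε ≤ (√(k : ℝ)) ^ ε := by gcongr
      _ = (k : ℝ) ^ (ε / 2) := by
        rw [sqrt_eq_rpow, ← rpow_mul hk.le]; congr 1; ring
  have hsplit : (k : ℝ) ^ (1.5 * (1 + ε)) =
      (k : ℝ) ^ (1.5 : ℝ) * (k : ℝ) ^ ε * (k : ℝ) ^ (ε / 2) := by
    rw [← rpow_add hk, ← rpow_add hk]; congr 1; ring
  have hmain : 4 * ((k : ℝ) ^ (1.5 : ℝ) * (k : ℝ) ^ ε) / n ≤ d := by
    have h := hpow.trans hdε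
    rw [hsplit] at h
    refine le_of_mul_le_mul_right ?_ (show 0 < (k : ℝ) ^ (ε / 2) by positivity)
    refine le_trans (le_of_eq ?_) h
    ring
  have hk2 : (k : ℝ) ^ 2 = (k : ℝ) ^ (1.5 : ℝ) * √k := by
    rw [sqrt_eq_rpow, ← rpow_add hk, ← rpow_natCast]; norm_num
  calc exp 4 * (k : ℝ) ^ 2 / n ≤ 4 * (k : ℝ) ^ ε * (k : ℝ) ^ 2 / n := by gcongr
    _ = 4 * ((k : ℝ) ^ (1.5 : ℝ) * (k : ℝ) ^ ε) / n * √k := by rw [hk2]; ring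
    _ ≤ d * √k := by gcongr

/-- analysis of the sum `B`: for `m ≤ c·(k^{1.5}/d)·log k` and `d` in the
admissible range, the sum of `P[F_S ∩ F_T]` over all `T` of size `k` with
`d√k ≤ |S ∩ T| ≤ 0.9k` is at most `0.25 · C(n,k) · P[F_S]²`. -/
theorem sum_B_upper_bound (ε : ℝ) (hε1 : 0 < ε) (hε2 : ε < 2/3) :
    ∃ c : ℝ, 0 < c ∧ ∃ K : ℕ, ∀ k n m : ℕ, K ≤ k →
      (k : ℝ) ≤ (n : ℝ) ^ ((2:ℝ)/3 - ε) →
      ∀ d : ℝ,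
        max ((4:ℝ) ^ (1/(1+ε)) * (k : ℝ) ^ (1.5:ℝ) / (n : ℝ) ^ (1/(1+ε)))
            ((k : ℝ) ^ (ε - 0.5) * Real.sqrt (4 * Real.log m)) ≤ d →
        d ≤ Real.sqrt (4 * Real.log m) →
        (m : ℝ) ≤ c * ((k : ℝ) ^ (1.5:ℝ) / d) * Real.log k →
        ∀ S : Finset (Fin n), S.card = k →
          ∑ T ∈ ((Finset.univ : Finset (Fin n)).powersetCard k).filter
              (fun T => d * Real.sqrt k ≤ ((S ∩ T).card : ℝ) ∧
                ((S ∩ T).card : ℝ) ≤ 0.9 * k),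
            gaussMat m n (FEvent m n d S ∩ FEvent m n d T) ≤
          (1/4 : ℝ≥0∞) * (n.choose k : ℝ≥0∞) * (gaussMat m n (FEvent m n d S)) ^ 2 := by
  obtain ⟨K, hK⟩ := Filter.eventually_atTop.1 (eventually_log_bounds hε1)
  refine ⟨1, one_pos, K, fun k n m hKk hkn d hdl hdu hm S hS ↦ ?_⟩
  obtain ⟨hlog, hlog3, hkε⟩ := hK k hKk
  have hk : 0 < k := by
    rcases Nat.eq_zero_or_pos k with rfl | h
    · norm_num at hlog
    · exact h
  have hk1 : (1 : ℝ) ≤ k := by exact_mod_cast hk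
  have hk0 : (0 : ℝ) < k := by linarith
  have hn : 0 < n := hk.trans_le (by simpa [hS] using Finset.card_le_univ S)
  have hn0 : (0 : ℝ) < n := by exact_mod_cast hn
  obtain ⟨hd1, hd2⟩ := max_le_iff.1 hdl
  have hd0 : 0 < d := lt_of_lt_of_le (by positivity) hd1
  have hm2 : 2 ≤ m := by
    by_contra! h
    interval_cases m <;> simp at hdu <;> linarith
  have hlogm : 1 ≤ 4 * log m := by
    have : log 2 ≤ log m := log_le_log (by norm_num) (by exact_mod_cast hm2)
    linarith [log_two_gt_d9]
  have hD : 1 ≤ √(4 * log m) := Real.one_le_sqrt.2 hlogm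
  have hdε : (k : ℝ) ^ (ε - 0.5) ≤ d := (le_mul_of_one_le_right (by positivity) hD).trans hd2
  rw [one_mul] at hm
  have hlogmk := log_le_three_mul_log hε1 hk1 (by omega) hdε hm
  have hdsq : d ^ 2 ≤ 12 * log k := by
    calc d ^ 2 ≤ √(4 * log m) ^ 2 := by gcongr
      _ = 4 * log m := Real.sq_sqrt (by linarith)
      _ ≤ 12 * log k := by linarith
  have hsk : 0 < √(k : ℝ) := Real.sqrt_pos.2 hk0
  have hsk2 : √(k : ℝ) ^ 2 = k := Real.sq_sqrt hk0.le
  obtain ⟨δ, hδ⟩ : ∃ δ, d = δ * √k := ⟨d / √k, by field_simp⟩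
  have hδ0 : 0 < δ := by
    by_contra! h
    nlinarith
  have hδk : d * √k = δ * k := by rw [hδ, mul_assoc, ← sq, hsk2]
  have hδlog : 48 * δ * log k ≤ 1 := by
    have hsq : δ ^ 2 * k ≤ 12 * log k := by rwa [hδ, mul_pow, hsk2] at hdsq
    have h : (48 * δ * log k) ^ 2 ≤ 1 := by
      refine le_of_mul_le_mul_right ?_ hk0
      calc (48 * δ * log k) ^ 2 * k = 2304 * log k ^ 2 * (δ ^ 2 * k) := by ring
        _ ≤ 2304 * log k ^ 2 * (12 * log k) := by gcongr
        _ = 27648 * log k ^ 3 := by ring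
        _ ≤ 1 * k := by linarith
    exact (sq_le_one_iff₀ (by positivity)).1 h
  have hδ1 : δ ≤ 1 / 48 := by nlinarith
  have hdk : d ≤ √k := by
    rw [hδ]
    exact mul_le_of_le_one_left hsk.le (by linarith)
  have hL1 : 1 ≤ d * √k := by
    calc (1 : ℝ) ≤ (k : ℝ) ^ ε := one_le_rpow hk1 hε1.le
      _ = (k : ℝ) ^ (ε - 0.5) * √k := by
        rw [sqrt_eq_rpow, ← rpow_add hk0]; norm_num
      _ ≤ d * √k := by gcongr
  have hmδ : δ * m ≤ k * log k := by
    have h15 : (k : ℝ) ^ (1.5 : ℝ) = k * √k := by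
      rw [sqrt_eq_rpow, ← rpow_one_add' hk0.le (by norm_num)]; norm_num
    calc δ * m ≤ δ * (k * √k / (δ * √k) * log k) := by
          rw [← hδ, ← h15]
          gcongr
      _ = k * log k := by field_simp
  set P := gaussMat m n (FEvent m n d S)
  set p : Finset (Fin n) → Prop := fun T ↦
    d * √k ≤ ((S ∩ T).card : ℝ) ∧ ((S ∩ T).card : ℝ) ≤ 0.9 * k
  have hterm : ∀ T ∈ ((Finset.univ : Finset (Fin n)).powersetCard k).filter p,
      gaussMat m n (FEvent m n d S ∩ FEvent m n d T) ≤
        ENNReal.ofReal (exp (S ∩ T).card) * P ^ 2 := by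
    intro T hT
    obtain ⟨hTk, hTl, hTu⟩ := Finset.mem_filter.1 hT
    obtain ⟨ρ, hρ⟩ : ∃ ρ : ℝ, ((S ∩ T).card : ℝ) = ρ * k :=
      ⟨(S ∩ T).card / k, by field_simp⟩
    have hδρ : δ ≤ ρ := by
      rw [hδk, hρ] at hTl
      exact le_of_mul_le_mul_right hTl hk0
    have hρ1 : ρ ≤ 0.9 := by
      rw [hρ] at hTu
      exact le_of_mul_le_mul_right hTu hk0
    refine (gaussMat_FEvent_inter_le hk hS (Finset.mem_powersetCard.1 hTk).2 hρ hd0.le hδ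
      (by linarith) hδρ hρ1).trans ?_
    gcongr
    have hρ0 : 0 ≤ ρ := hδ0.le.trans hδρ
    calc 48 * (δ ^ 2 * ρ ^ 2) * m = 48 * δ * ρ ^ 2 * (δ * m) := by ring
      _ ≤ 48 * δ * ρ ^ 2 * (k * log k) := by gcongr
      _ = (48 * δ * log k) * (ρ * (ρ * k)) := by ring
      _ ≤ 1 * (1 * (ρ * k)) := by
          gcongr
          linarith
      _ = (S ∩ T).card := by rw [hρ]; ring
  calc _ ≤ ∑ T ∈ ((Finset.univ : Finset (Fin n)).powersetCard k).filter p,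
        ENNReal.ofReal (exp (S ∩ T).card) * P ^ 2 := Finset.sum_le_sum hterm
    _ = ENNReal.ofReal (∑ T ∈ ((Finset.univ : Finset (Fin n)).powersetCard k).filter p,
          exp (S ∩ T).card) * P ^ 2 := by
        rw [← Finset.sum_mul, ENNReal.ofReal_sum_of_nonneg fun _ _ ↦ exp_nonneg _]
    _ ≤ ENNReal.ofReal (1 / 4 * n.choose k) * P ^ 2 := by
        gcongr
        exact sum_exp_card_inter_le hS (exp_four_mul_sq_div_le hε1 hk0 hn0 hdk hkε hd1) hL1 p
          fun T hT ↦ hT.1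
    _ = _ := by
        rw [ENNReal.ofReal_mul (by norm_num), ENNReal.ofReal_natCast,
          ENNReal.ofReal_div_of_pos (by norm_num)]
        simp
end

section
/- Fix ε ∈ (0, 2/3). There exists a constant c > 0 such that for all sufficiently large k and n with k ≤ n^(2/3 − ε), all m, and all d satisfying max(4^(1/(1+ε))·k^1.5/n^(1/(1+ε)), k^(ε−0.5)·√(4 log m)) ≤ d ≤ √(4 log m) and m ≤ c·(k^1.5/d)·log k, the following holds: let v_1, …, v_m be independent random vectors in ℝ^n with i.i.d. standard Gaussian N(0,1) entries, and for a subset U ⊆ {1,…,n} of size k let F_U denote the event that |Σ_{i∈U} (v_j)_i| > d for every j ∈ {1,…,m}. Then for every S ⊆ {1,…,n} with |S| = k, Σ_{T} P[F_S ∩ F_T] ≤ 0.25 · C(n,k) · P[F_S]², where the sum ranges over all T ⊆ {1,…,n} with |T| = k and |S ∩ T| ≥ 0.9·k and T ≠ S is allowed to equal S or not. -/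
open MeasureTheory ProbabilityTheory
open scoped NNReal ENNReal

/-- A sum of `S.card` coordinates of a standard Gaussian vector has law `N(0, S.card)`. -/
lemma gaussVec_map_sum (n : ℕ) (S : Finset (Fin n)) :
    (gaussVec n).map (fun v => ∑ i ∈ S, v i) = gaussianReal 0 S.card := by
  have hind : iIndepFun (fun (i : Fin n) (v : Fin n → ℝ) => v i) (gaussVec n) :=
    iIndepFun_pi (μ := fun _ : Fin n => gaussianReal 0 1) (X := fun _ => id)
      (fun _ => aemeasurable_id)
  have hlaw (i : Fin n) : (gaussVec n).map (fun v => v i) = gaussianReal 0 1 :=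
    (measurePreserving_eval (fun _ : Fin n => gaussianReal 0 1) i).map_eq
  have : IsProbabilityMeasure (gaussVec n) := by unfold gaussVec; infer_instance
  have hmeas : Measurable fun v : Fin n → ℝ => ∑ i ∈ S, v i := by fun_prop
  have := Measure.isProbabilityMeasure_map (μ := gaussVec n) hmeas.aemeasurable
  apply Measure.ext_of_charFun
  rw [(hind.restrict S).charFun_map_fun_finsetSum_eq_prod
    (fun i _ => (measurable_pi_apply i).aemeasurable)]
  ext t
  simp only [hlaw, Finset.prod_const, Pi.pow_apply, charFun_gaussianReal, ← Complex.exp_nat_mul]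
  congr 1
  push_cast
  ring

lemma gaussianReal_abs_le (k : ℕ) (hk : 0 < k) (d : ℝ) :
    gaussianReal 0 k {x | |x| ≤ d} ≤ ENNReal.ofReal (d / √k) := by
  have hk' : (0 : ℝ) < k := by exact_mod_cast hk
  have hset : {x : ℝ | |x| ≤ d} = Set.Icc (-d) d := by
    ext x
    simp [abs_le]
  have hpdf (x : ℝ) : gaussianPDF 0 k x ≤ ENNReal.ofReal ((2 * √k)⁻¹) := by
    refine ENNReal.ofReal_le_ofReal ?_
    have hexp : Real.exp (-(x - 0) ^ 2 / (2 * ((k : ℝ≥0) : ℝ))) ≤ 1 := by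
      rw [Real.exp_le_one_iff, neg_div]
      exact neg_nonpos.2 (by positivity)
    have hsqrt : 2 * √k ≤ √(2 * Real.pi * ((k : ℝ≥0) : ℝ)) := by
      apply Real.le_sqrt_of_sq_le
      rw [mul_pow, Real.sq_sqrt hk'.le]
      push_cast
      nlinarith [Real.pi_gt_three]
    calc gaussianPDFReal 0 k x ≤ (√(2 * Real.pi * ((k : ℝ≥0) : ℝ)))⁻¹ * 1 := by
          unfold gaussianPDFReal
          gcongr
      _ ≤ (2 * √k)⁻¹ := by
          rw [mul_one]
          gcongr
  rw [gaussianReal_apply 0 (by exact_mod_cast hk.ne'), hset]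
  calc ∫⁻ x in Set.Icc (-d) d, gaussianPDF 0 k x
      ≤ ∫⁻ _ in Set.Icc (-d) d, ENNReal.ofReal ((2 * √k)⁻¹) := lintegral_mono hpdf
    _ = ENNReal.ofReal ((2 * √k)⁻¹) * ENNReal.ofReal (d - -d) := by simp
    _ = ENNReal.ofReal (d / √k) := by
        rw [← ENNReal.ofReal_mul (by positivity)]
        congr 1
        field_simp
        ring

lemma exp_neg_two_mul_le_one_sub {q : ℝ} (h0 : 0 ≤ q) (h1 : q ≤ 1 / 2) :
    Real.exp (-(2 * q)) ≤ 1 - q := by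
  rw [Real.exp_neg]
  calc (Real.exp (2 * q))⁻¹ ≤ (2 * q + 1)⁻¹ := by
        gcongr
        exact Real.add_one_le_exp _
    _ ≤ 1 - q := by
        rw [inv_le_iff_one_le_mul₀ (by positivity)]
        nlinarith

lemma le_gaussMat_FEvent (m n k : ℕ) (hk : 0 < k) (d : ℝ) (hd : 0 ≤ d) (hdk : d / √k ≤ 1 / 2)
    (S : Finset (Fin n)) (hS : S.card = k) :
    ENNReal.ofReal (Real.exp (-(2 * (m * (d / √k))))) ≤ gaussMat m n (FEvent m n d S) := by
  have : IsProbabilityMeasure (gaussVec n) := by unfold gaussVec; infer_instance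
  have hmeas : Measurable fun v : Fin n → ℝ => ∑ i ∈ S, v i := by fun_prop
  have hset : MeasurableSet {x : ℝ | |x| ≤ d} := measurableSet_le (by fun_prop) (by fun_prop)
  have hsmall : gaussVec n {v | |∑ i ∈ S, v i| ≤ d} ≤ ENNReal.ofReal (d / √k) := by
    have h := gaussianReal_abs_le k hk d
    rwa [← hS, ← gaussVec_map_sum, Measure.map_apply hmeas hset, hS] at h
  have hone : ENNReal.ofReal (Real.exp (-(2 * (d / √k)))) ≤
      gaussVec n {v | d < |∑ i ∈ S, v i|} := by
    have hcompl : {v : Fin n → ℝ | d < |∑ i ∈ S, v i|} = {v | |∑ i ∈ S, v i| ≤ d}ᶜ := by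
      ext v
      simp
    rw [hcompl,
      prob_compl_eq_one_sub (show MeasurableSet {v : Fin n → ℝ | |∑ i ∈ S, v i| ≤ d} from hmeas hset)]
    calc ENNReal.ofReal (Real.exp (-(2 * (d / √k)))) ≤ ENNReal.ofReal (1 - d / √k) :=
          ENNReal.ofReal_le_ofReal (exp_neg_two_mul_le_one_sub (by positivity) hdk)
      _ = 1 - ENNReal.ofReal (d / √k) := by
          rw [ENNReal.ofReal_sub _ (by positivity), ENNReal.ofReal_one]
      _ ≤ _ := tsub_le_tsub_left hsmall 1
  have hpi : FEvent m n d S =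
      Set.univ.pi fun _ : Fin m => {v : Fin n → ℝ | d < |∑ i ∈ S, v i|} := by
    ext v
    simp [FEvent]
  rw [hpi, gaussMat, Measure.pi_pi, Finset.prod_const, Finset.card_univ, Fintype.card_fin]
  calc ENNReal.ofReal (Real.exp (-(2 * (m * (d / √k)))))
      = ENNReal.ofReal (Real.exp (-(2 * (d / √k)))) ^ m := by
        rw [← ENNReal.ofReal_pow (Real.exp_nonneg _), ← Real.exp_nat_mul]
        congr 2
        ring
    _ ≤ _ := pow_le_pow_left' hone m

/-- Few `k`-sets meet a given `k`-set in at least `9k/10` elements. -/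
lemma card_filter_large_inter_le (n k : ℕ) (S : Finset (Fin n)) (hS : S.card = k) :
    (((Finset.univ : Finset (Fin n)).powersetCard k).filter
      (fun T => 0.9 * k ≤ ((S ∩ T).card : ℝ))).card ≤
      2 ^ k * ∑ i ∈ Finset.range (k / 10 + 1), n.choose i := by
  calc _ ≤ (S.powerset ×ˢ (Finset.range (k / 10 + 1)).biUnion
        fun i => (Finset.univ : Finset (Fin n)).powersetCard i).card := by
        refine Finset.card_le_card_of_injOn (fun T => (S ∩ T, T \ S)) ?_ ?_
        · intro T hT
          simp only [Finset.coe_filter, Finset.mem_powersetCard_univ, Set.mem_ofPred_eq] at hT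
          obtain ⟨hTk, hT⟩ := hT
          have h9 : 9 * k ≤ 10 * (S ∩ T).card := by
            have : (9 : ℝ) * k ≤ 10 * (S ∩ T).card := by linarith
            exact_mod_cast this
          have hadd := Finset.card_inter_add_card_sdiff T S
          rw [Finset.inter_comm] at hadd
          simp only [Finset.coe_product, Set.mem_prod, Finset.mem_coe, Finset.mem_powerset,
            Finset.mem_biUnion, Finset.mem_range, Finset.mem_powersetCard_univ]
          exact ⟨Finset.inter_subset_left, _, by omega, rfl⟩
        · intro T _ T' _ h
          simp only [Prod.mk.injEq] at h
          rw [← Finset.sdiff_union_inter T S, ← Finset.sdiff_union_inter T' S, h.2,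
            Finset.inter_comm T, Finset.inter_comm T', h.1]
    _ ≤ _ := by
        rw [Finset.card_product, Finset.card_powerset, hS]
        gcongr
        refine Finset.card_biUnion_le.trans (le_of_eq ?_)
        simp

lemma choose_mul_pow_le {n k i : ℕ} (hik : i ≤ k) (hk : 0 < k) (hkn : k ≤ n) {x : ℝ}
    (hx : 0 ≤ x) (hxn : x * k ≤ n - k) :
    (n.choose i : ℝ) * x ^ (k - i) ≤ n.choose k * 2 ^ k := by
  have hk' : (0 : ℝ) < k := by exact_mod_cast hk
  have hpow : x ^ (k - i) ≤ ((n - i).choose (k - i) : ℝ) := by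
    have hsub : n - i + 1 - (k - i) = n - k + 1 := by omega
    have hfact : ((k - i).factorial : ℝ) ≤ (k : ℝ) ^ (k - i) := by
      exact_mod_cast (Nat.factorial_le_pow _).trans (Nat.pow_le_pow_left (Nat.sub_le k i) _)
    refine le_trans ?_ (Nat.pow_le_choose (α := ℝ) (k - i) (n - i))
    rw [hsub, le_div_iff₀ (by positivity)]
    calc x ^ (k - i) * ((k - i).factorial : ℝ) ≤ x ^ (k - i) * (k : ℝ) ^ (k - i) := by gcongr
      _ = (x * k) ^ (k - i) := (mul_pow _ _ _).symm
      _ ≤ ((n - k + 1 : ℕ) : ℝ) ^ (k - i) := by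
          gcongr
          push_cast [Nat.cast_sub hkn]
          linarith
  have hchoose : (k.choose i : ℝ) ≤ 2 ^ k := by exact_mod_cast Nat.choose_le_two_pow k i
  have hmul : (n.choose k : ℝ) * k.choose i = n.choose i * (n - i).choose (k - i) := by
    exact_mod_cast Nat.choose_mul hik
  calc (n.choose i : ℝ) * x ^ (k - i) ≤ n.choose i * (n - i).choose (k - i) := by gcongr
    _ = n.choose k * k.choose i := hmul.symm
    _ ≤ _ := by gcongr

lemma eight_pow_mul_exp_le {k i : ℕ} (hk : 65536 ≤ k) (hi : i ≤ k / 10) :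
    (8 : ℝ) ^ k * Real.exp (k * Real.log k / 10) ≤ (√k / 2) ^ (k - i) := by
  have hk' : (65536 : ℝ) ≤ k := by exact_mod_cast hk
  have hlog2 : 0 < Real.log 2 := Real.log_pos one_lt_two
  have hlogk : 16 * Real.log 2 ≤ Real.log k := by
    calc 16 * Real.log 2 = Real.log (2 ^ 16) := by rw [Real.log_pow]; norm_num
      _ ≤ Real.log k := Real.log_le_log (by norm_num) (by norm_num; exact hk)
  have hx : 0 < √(k : ℝ) / 2 := by positivity
  have hlogx : Real.log (√k / 2) = Real.log k / 2 - Real.log 2 := by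
    rw [Real.log_div (by positivity) two_ne_zero, Real.log_sqrt (by positivity)]
  have hsub : 0.9 * (k : ℝ) ≤ ((k - i : ℕ) : ℝ) := by
    have h : 9 * k ≤ 10 * (k - i) := by omega
    have : (9 : ℝ) * k ≤ 10 * ((k - i : ℕ) : ℝ) := by exact_mod_cast h
    linarith
  have h8 : (8 : ℝ) ^ k = Real.exp (k * (3 * Real.log 2)) := by
    have : Real.exp (3 * Real.log 2) = 8 := by
      rw [show (3 : ℝ) = (3 : ℕ) by norm_num, Real.exp_nat_mul, Real.exp_log two_pos]
      norm_num
    rw [Real.exp_nat_mul, this]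
  have hpow : (√(k : ℝ) / 2) ^ (k - i) =
      Real.exp (((k - i : ℕ) : ℝ) * (Real.log k / 2 - Real.log 2)) := by
    rw [Real.exp_nat_mul, ← hlogx, Real.exp_log hx]
  rw [h8, hpow, ← Real.exp_add, Real.exp_le_exp]
  calc k * (3 * Real.log 2) + k * Real.log k / 10
      ≤ 0.9 * (k : ℝ) * (Real.log k / 2 - Real.log 2) := by nlinarith
    _ ≤ _ := mul_le_mul_of_nonneg_right hsub (by linarith)

lemma mul_sqrt_le_of_le_rpow {k n : ℕ} {a : ℝ} (ha : a ≤ 2 / 3) (hn : 1 ≤ n)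
    (h : (k : ℝ) ≤ (n : ℝ) ^ a) : (k : ℝ) * √k ≤ n := by
  have hn' : (1 : ℝ) ≤ n := by exact_mod_cast hn
  have h23 : (k : ℝ) ≤ (n : ℝ) ^ (2 / 3 : ℝ) := h.trans (Real.rpow_le_rpow_of_exponent_le hn' ha)
  calc (k : ℝ) * √k ≤ (n : ℝ) ^ (2 / 3 : ℝ) * √((n : ℝ) ^ (2 / 3 : ℝ)) := by gcongr
    _ = n := by
        rw [Real.sqrt_eq_rpow, ← Real.rpow_mul (by positivity), ← Real.rpow_add (by positivity)]
        norm_num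

/-- The number of `k`-sets having a large intersection with a fixed `k`-set, compared with the
number of all `k`-sets. -/
lemma card_filter_large_inter_le_choose {n k : ℕ} (hk : 65536 ≤ k) (hkn : (k : ℝ) * √k ≤ n)
    (S : Finset (Fin n)) (hS : S.card = k) :
    ((((Finset.univ : Finset (Fin n)).powersetCard k).filter
      (fun T => 0.9 * k ≤ ((S ∩ T).card : ℝ))).card : ℝ) ≤
      1 / 4 * n.choose k * Real.exp (-(k * Real.log k / 10)) := by
  have hk' : (65536 : ℝ) ≤ k := by exact_mod_cast hk
  have hsqrt : (256 : ℝ) ≤ √k := Real.le_sqrt_of_sq_le (by norm_num; exact hk)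
  have hkn' : k ≤ n := by
    have : (k : ℝ) ≤ n := by nlinarith
    exact_mod_cast this
  set E := Real.exp (k * Real.log k / 10) with hE
  have hEpos : 0 < E := Real.exp_pos _
  have hterm (i : ℕ) (hi : i ∈ Finset.range (k / 10 + 1)) :
      (n.choose i : ℝ) ≤ n.choose k * 2 ^ k / (8 ^ k * E) := by
    have hi' : i ≤ k / 10 := by simpa [Nat.lt_succ_iff] using hi
    rw [le_div_iff₀ (by positivity)]
    calc (n.choose i : ℝ) * (8 ^ k * E) ≤ n.choose i * (√k / 2) ^ (k - i) := by
          gcongr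
          exact eight_pow_mul_exp_le hk hi'
      _ ≤ _ := choose_mul_pow_le (by omega) (by omega) hkn' (by positivity) (by nlinarith)
  have hcount : 4 * ((k / 10 + 1 : ℕ) : ℝ) ≤ 2 ^ k := by
    have h1 : 4 * (k / 10 + 1) ≤ k := by omega
    exact_mod_cast h1.trans Nat.lt_two_pow_self.le
  have hcard : ((((Finset.univ : Finset (Fin n)).powersetCard k).filter
      (fun T => 0.9 * k ≤ ((S ∩ T).card : ℝ))).card : ℝ) ≤
      2 ^ k * ∑ i ∈ Finset.range (k / 10 + 1), (n.choose i : ℝ) := by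
    exact_mod_cast card_filter_large_inter_le n k S hS
  have h8 : (8 : ℝ) ^ k = 2 ^ k * 2 ^ k * 2 ^ k := by
    rw [← mul_pow, ← mul_pow]
    norm_num
  calc _ ≤ (2 : ℝ) ^ k * ∑ i ∈ Finset.range (k / 10 + 1), (n.choose i : ℝ) := hcard
    _ ≤ 2 ^ k * ((k / 10 + 1 : ℕ) * (n.choose k * 2 ^ k / (8 ^ k * E))) := by
        gcongr
        simpa using Finset.sum_le_card_nsmul _ _ _ hterm
    _ ≤ 2 ^ k * (2 ^ k / 4 * (n.choose k * 2 ^ k / (8 ^ k * E))) := by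
        gcongr
        linarith
    _ = 1 / 4 * n.choose k * Real.exp (-(k * Real.log k / 10)) := by
        rw [Real.exp_neg, ← hE, h8]
        field_simp

/-- In the admissible range, the threshold `d` is positive, small compared with `√k`, and the
expected number of balanced vectors is at most of order `k log k`. -/
lemma threshold_bounds {ε : ℝ} (hε : 0 < ε) {k n m : ℕ} (hk : 65536 ≤ k) (hn : 1 ≤ n) {d : ℝ}
    (hlow : max ((4:ℝ) ^ (1/(1+ε)) * (k : ℝ) ^ (1.5:ℝ) / (n : ℝ) ^ (1/(1+ε)))
      ((k : ℝ) ^ (ε - 0.5) * √(4 * Real.log m)) ≤ d)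
    (hup : d ≤ √(4 * Real.log m))
    (hm : (m : ℝ) ≤ 1 / 20 * ((k : ℝ) ^ (1.5:ℝ) / d) * Real.log k) :
    0 < d ∧ d / √k ≤ 1 / 2 ∧ 2 * (m * (d / √k)) ≤ k * Real.log k / 10 := by
  have hk' : (65536 : ℝ) ≤ k := by exact_mod_cast hk
  have hkpos : (0 : ℝ) < k := by linarith
  have hn' : (0 : ℝ) < n := by exact_mod_cast hn
  have hsqrt : (256 : ℝ) ≤ √k := Real.le_sqrt_of_sq_le (by norm_num; exact hk)
  have hsq : √(k : ℝ) * √k = k := Real.mul_self_sqrt hkpos.le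
  have hd : 0 < d := lt_of_lt_of_le (by positivity) ((le_max_left _ _).trans hlow)
  have hlogm : 0 < Real.log m := by
    by_contra! h
    rw [Real.sqrt_eq_zero_of_nonpos (by linarith)] at hup
    linarith
  have hm2 : 2 ≤ m := by
    by_contra! h
    interval_cases m <;> simp at hlogm
  have hm2' : (2 : ℝ) ≤ m := by exact_mod_cast hm2
  have hlogm2 : 1 ≤ √(4 * Real.log m) := by
    apply Real.le_sqrt_of_sq_le
    have := Real.log_le_log two_pos hm2'
    linarith [Real.log_two_gt_d9]
  have hrpow : (k : ℝ) ^ (1.5 : ℝ) = k * √k := by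
    rw [Real.sqrt_eq_rpow, ← Real.rpow_one_add' hkpos.le (by norm_num)]
    norm_num
  have hlogk : Real.log k ≤ 2 * √k := by
    have := Real.log_le_self (Real.sqrt_nonneg k)
    rw [Real.log_sqrt hkpos.le] at this
    linarith
  have hlogk0 : 0 ≤ Real.log k := Real.log_nonneg (by linarith)
  have hmd : m * d ≤ 1 / 20 * (k * √k) * Real.log k := by
    rw [hrpow] at hm
    calc m * d ≤ 1 / 20 * (k * √k / d) * Real.log k * d := by gcongr
      _ = _ := by field_simp
  have hdlow : 1 ≤ d * √k := by
    have h1 : (k : ℝ) ^ (-(1 / 2) : ℝ) ≤ d := by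
      calc (k : ℝ) ^ (-(1 / 2) : ℝ) ≤ (k : ℝ) ^ (ε - 0.5) :=
            Real.rpow_le_rpow_of_exponent_le (by linarith) (by norm_num; linarith)
        _ ≤ (k : ℝ) ^ (ε - 0.5) * √(4 * Real.log m) :=
            le_mul_of_one_le_right (by positivity) hlogm2
        _ ≤ d := (le_max_right _ _).trans hlow
    rw [Real.rpow_neg hkpos.le, ← Real.sqrt_eq_rpow] at h1
    rwa [inv_le_iff_one_le_mul₀ (by positivity)] at h1
  have hmk : (m : ℝ) ≤ (k : ℝ) ^ 3 := by
    calc (m : ℝ) ≤ m * (d * √k) := le_mul_of_one_le_right (by positivity) hdlow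
      _ = m * d * √k := by ring
      _ ≤ 1 / 20 * (k * √k) * Real.log k * √k := by gcongr
      _ = 1 / 20 * k * Real.log k * (√k * √k) := by ring
      _ = 1 / 20 * (k ^ 2 * Real.log k) := by rw [hsq]; ring
      _ ≤ k ^ 2 * k := by
          have : (k : ℝ) ^ 2 * Real.log k ≤ k ^ 2 * k := by
            gcongr
            exact Real.log_le_self hkpos.le
          have : 0 ≤ (k : ℝ) ^ 2 * Real.log k := by positivity
          linarith
      _ = (k : ℝ) ^ 3 := by ring
  have hlogmk : Real.log m ≤ 3 * Real.log k := by
    have := Real.log_le_log (by linarith) hmk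
    rwa [Real.log_pow] at this
  refine ⟨hd, ?_, ?_⟩
  · rw [div_le_iff₀ (by positivity)]
    refine hup.trans (Real.sqrt_le_iff.2 ⟨by positivity, ?_⟩)
    nlinarith
  · calc 2 * (m * (d / √k)) = 2 * (m * d) / √k := by ring
      _ ≤ 2 * (1 / 20 * (k * √k) * Real.log k) / √k := by gcongr
      _ = k * Real.log k / 10 := by
          field_simp
          ring

/-- analysis of the sum `C`: for `m ≤ c·(k^{1.5}/d)·log k` and `d` in the
admissible range, the sum of `P[F_S ∩ F_T]` over all `T` of size `k` with
`|S ∩ T| ≥ 0.9k` (`T = S` allowed) is at most `0.25 · C(n,k) · P[F_S]²`. -/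
theorem sum_C_upper_bound (ε : ℝ) (hε1 : 0 < ε) (hε2 : ε < 2/3) :
    ∃ c : ℝ, 0 < c ∧ ∃ K : ℕ, ∀ k n m : ℕ, K ≤ k → K ≤ n →
      (k : ℝ) ≤ (n : ℝ) ^ ((2:ℝ)/3 - ε) →
      ∀ d : ℝ,
        max ((4:ℝ) ^ (1/(1+ε)) * (k : ℝ) ^ (1.5:ℝ) / (n : ℝ) ^ (1/(1+ε)))
            ((k : ℝ) ^ (ε - 0.5) * Real.sqrt (4 * Real.log m)) ≤ d →
        d ≤ Real.sqrt (4 * Real.log m) →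
        (m : ℝ) ≤ c * ((k : ℝ) ^ (1.5:ℝ) / d) * Real.log k →
        ∀ S : Finset (Fin n), S.card = k →
          ∑ T ∈ ((Finset.univ : Finset (Fin n)).powersetCard k).filter
              (fun T => 0.9 * k ≤ ((S ∩ T).card : ℝ)),
            gaussMat m n (FEvent m n d S ∩ FEvent m n d T) ≤
          (1/4 : ℝ≥0∞) * (n.choose k : ℝ≥0∞) * (gaussMat m n (FEvent m n d S)) ^ 2 := by
  refine ⟨1 / 20, by norm_num, 65536, fun k n m hk hn hkn d hlow hup hm S hS => ?_⟩
  obtain ⟨hd, hdk, hmd⟩ := threshold_bounds hε1 hk (by omega) hlow hup hm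
  have hn32 := mul_sqrt_le_of_le_rpow (by linarith) (by omega) hkn
  have hcard := card_filter_large_inter_le_choose hk hn32 S hS
  set 𝒯 := ((Finset.univ : Finset (Fin n)).powersetCard k).filter
    (fun T => 0.9 * k ≤ ((S ∩ T).card : ℝ))
  set p := gaussMat m n (FEvent m n d S)
  have hp : ENNReal.ofReal (Real.exp (-(k * Real.log k / 10))) ≤ p :=
    (ENNReal.ofReal_le_ofReal (Real.exp_le_exp.2 (neg_le_neg hmd))).trans
      (le_gaussMat_FEvent m n k (by omega) d hd.le hdk S hS)
  have hcardp : (𝒯.card : ℝ≥0∞) ≤ 1 / 4 * n.choose k * p := by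
    calc (𝒯.card : ℝ≥0∞) = ENNReal.ofReal 𝒯.card := (ENNReal.ofReal_natCast _).symm
      _ ≤ ENNReal.ofReal (1 / 4 * n.choose k * Real.exp (-(k * Real.log k / 10))) :=
          ENNReal.ofReal_le_ofReal hcard
      _ = 1 / 4 * n.choose k * ENNReal.ofReal (Real.exp (-(k * Real.log k / 10))) := by
          rw [ENNReal.ofReal_mul (by positivity), ENNReal.ofReal_mul (by positivity),
            ENNReal.ofReal_natCast, ENNReal.ofReal_div_of_pos (by norm_num)]
          simp
      _ ≤ _ := by gcongr
  calc ∑ T ∈ 𝒯, gaussMat m n (FEvent m n d S ∩ FEvent m n d T) ≤ ∑ _T ∈ 𝒯, p :=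
        Finset.sum_le_sum fun T _ => measure_mono Set.inter_subset_left
    _ = 𝒯.card * p := by rw [Finset.sum_const, nsmul_eq_mul]
    _ ≤ 1 / 4 * n.choose k * p * p := by gcongr
    _ = _ := by ring
end

section
/- Fix ε ∈ (0, 2/3). There exists a constant c > 0 such that for all sufficiently large k and n with k ≤ n^(2/3 − ε) and all m with m ≤ c·k^1.5, the following holds: if A = (a_{i,j}) ∈ {−1, +1}^(m×n) is a random matrix whose entries are i.i.d. Rademacher random variables (each equal to +1 with probability 1/2 and −1 with probability 1/2), then with probability at least 1/2, A is not a valid universal 1-bit measurement matrix for support recovery on X_k(1). -/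
open MeasureTheory ProbabilityTheory
open scoped NNReal ENNReal

/-- The Rademacher distribution on `ℝ`: `+1` and `-1` each with probability `1/2`. -/
noncomputable def rademacherMeas : Measure ℝ :=
  (2⁻¹ : ℝ≥0∞) • Measure.dirac 1 + (2⁻¹ : ℝ≥0∞) • Measure.dirac (-1)

instance : IsProbabilityMeasure rademacherMeas := by
  constructor
  simp only [rademacherMeas, Measure.add_apply, Measure.smul_apply,
    Measure.dirac_apply_of_mem (Set.mem_univ _), smul_eq_mul, mul_one]
  exact ENNReal.inv_two_add_inv_two

/-- Law of a random vector in `ℝ^n` with i.i.d. Rademacher entries. -/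
noncomputable def radVec (n : ℕ) : Measure (Fin n → ℝ) :=
  Measure.pi fun _ => rademacherMeas

/-- Law of `m` independent random vectors in `ℝ^n` with i.i.d. Rademacher entries
(equivalently, an `m × n` random matrix with i.i.d. Rademacher entries). -/
noncomputable def radMat (m n : ℕ) : Measure (Fin m → Fin n → ℝ) :=
  Measure.pi fun _ => radVec n

/-- The largest atom of a sum of `s` independent Rademacher variables. -/
noncomputable def maxAtom (s : ℕ) : ℝ := (s.choose (s / 2) : ℝ) / 2 ^ s

theorem maxAtom_pos (s : ℕ) : 0 < maxAtom s :=
  div_pos (by exact_mod_cast Nat.choose_pos (Nat.div_le_self s 2)) (by positivity)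

theorem maxAtom_le_one (s : ℕ) : maxAtom s ≤ 1 := by
  rw [maxAtom, div_le_one (by positivity)]
  exact_mod_cast Nat.choose_le_two_pow s (s / 2)

theorem maxAtom_two_mul (a : ℕ) : maxAtom (2 * a) = (a.centralBinom : ℝ) / 4 ^ a := by
  rw [maxAtom, Nat.mul_div_cancel_left a two_pos, Nat.centralBinom, pow_mul]
  norm_num

theorem maxAtom_two_mul_succ (a : ℕ) :
    maxAtom (2 * (a + 1)) * (2 * a + 2) = maxAtom (2 * a) * (2 * a + 1) := by
  rw [maxAtom_two_mul, maxAtom_two_mul]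
  have h : ((a : ℝ) + 1) * (a + 1).centralBinom = 2 * (2 * a + 1) * a.centralBinom := by
    exact_mod_cast Nat.succ_mul_centralBinom_succ a
  field_simp
  rw [pow_succ]
  linear_combination 2 * 4 ^ a * h

theorem maxAtom_two_mul_add_one (a : ℕ) : maxAtom (2 * a + 1) = maxAtom (2 * (a + 1)) := by
  have h : (2 * (a + 1)).choose (a + 1) = 2 * (2 * a + 1).choose a := by
    rw [show 2 * (a + 1) = 2 * a + 1 + 1 by ring, Nat.choose_succ_succ, Nat.choose_symm_half]
    ring
  rw [maxAtom, maxAtom, show (2 * a + 1) / 2 = a by omega,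
    Nat.mul_div_cancel_left _ two_pos, h, show 2 * (a + 1) = 2 * a + 1 + 1 by ring,
    pow_succ _ (2 * a + 1)]
  push_cast
  field_simp

theorem monotone_two_mul_maxAtom : Monotone fun a : ℕ => 2 * (a : ℝ) * maxAtom (2 * a) := by
  refine monotone_nat_of_le_succ fun a => ?_
  have h := maxAtom_two_mul_succ a
  have h' := maxAtom_pos (2 * a)
  push_cast
  nlinarith

theorem mul_maxAtom_le {s a : ℕ} (h : s ≤ 2 * a) :
    (s : ℝ) * maxAtom s ≤ 2 * (a : ℝ) * maxAtom (2 * a) := by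
  obtain ⟨b, rfl | rfl⟩ := Nat.even_or_odd' s
  · have := monotone_two_mul_maxAtom (show b ≤ a by omega)
    simpa using this
  · have := monotone_two_mul_maxAtom (show b + 1 ≤ a by omega)
    rw [maxAtom_two_mul_add_one]
    refine le_trans ?_ this
    have := maxAtom_pos (2 * (b + 1))
    push_cast
    nlinarith

theorem maxAtom_two_mul_sq_le (a : ℕ) : (2 * a + 1) * maxAtom (2 * a) ^ 2 ≤ 1 := by
  induction a with
  | zero => simp [maxAtom]
  | succ a ih =>
    refine le_trans ?_ ih
    have h := maxAtom_two_mul_succ a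
    have ha : (0 : ℝ) < 2 * a + 2 := by positivity
    have h' : maxAtom (2 * (a + 1)) = maxAtom (2 * a) * (2 * a + 1) / (2 * a + 2) := by
      field_simp
      linarith
    rw [h', div_pow, mul_pow, mul_div_assoc', div_le_iff₀ (by positivity)]
    have : (0 : ℝ) ≤ maxAtom (2 * a) ^ 2 * (2 * a + 1) := by positivity
    push_cast
    nlinarith

theorem Finset.card_filter_card_inter_eq {α : Type*} [DecidableEq α] {S V : Finset α}
    (h : S ⊆ V) (x : ℕ) :
    (V.powerset.filter fun P => (P ∩ S).card = x).card =
      S.card.choose x * 2 ^ (V.card - S.card) := by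
  rw [← Finset.card_powersetCard, ← Finset.card_sdiff_of_subset h, ← Finset.card_powerset,
    ← Finset.card_product]
  refine Finset.card_nbij' (fun P => (P ∩ S, P \ S)) (fun Q => Q.1 ∪ Q.2) ?_ ?_ ?_ ?_
  · intro P hP
    simp only [Finset.coe_filter, Finset.mem_powerset, Set.mem_ofPred_eq] at hP
    simp only [Finset.coe_product, Set.mem_prod, Finset.mem_coe, Finset.mem_powersetCard,
      Finset.mem_powerset]
    exact ⟨⟨Finset.inter_subset_right, hP.2⟩, Finset.sdiff_subset_sdiff hP.1 le_rfl⟩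
  · rintro ⟨Q, R⟩ hQ
    simp only [Finset.coe_product, Set.mem_prod, Finset.mem_coe, Finset.mem_powersetCard,
      Finset.mem_powerset] at hQ
    simp only [Finset.coe_filter, Finset.mem_powerset, Set.mem_ofPred_eq]
    refine ⟨by grind, ?_⟩
    rw [← hQ.1.2]
    congr 1
    grind
  · intro P _
    grind
  · rintro ⟨Q, R⟩ hQ
    simp only [Finset.coe_product, Set.mem_prod, Finset.mem_coe, Finset.mem_powersetCard,
      Finset.mem_powerset] at hQ
    ext <;> grind

theorem Finset.card_filter_card_inter_eq_and_le {α : Type*} [DecidableEq α] {S T V : Finset α}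
    (hS : S ⊆ V) (hT : T ⊆ V) (x y : ℕ) :
    (V.powerset.filter fun P => (P ∩ S).card = x ∧ (P ∩ T).card = y).card ≤
      (T \ S).card.choose ((T \ S).card / 2) *
        (S.card.choose x * 2 ^ (V.card - (T \ S).card - S.card)) := by
  have hD : T \ S ⊆ V := Finset.sdiff_subset.trans hT
  have hSD : S ⊆ V \ (T \ S) := by grind
  rw [← Finset.card_sdiff_of_subset hD, ← Finset.card_filter_card_inter_eq hSD]
  refine (Finset.card_le_mul_card_image (f := fun P => P \ (T \ S)) _ _ ?_).trans
    (Nat.mul_le_mul_left _ (Finset.card_le_card ?_))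
  · intro Q _
    refine le_trans ?_ (Nat.choose_le_middle (y - (Q ∩ T).card) _)
    rw [← Finset.card_powersetCard]
    refine Finset.card_le_card_of_injOn (fun P => P ∩ (T \ S)) ?_ ?_
    · intro P hP
      simp only [Finset.coe_filter, Finset.mem_filter, Set.mem_ofPred_eq] at hP
      simp only [Finset.mem_coe, Finset.mem_powersetCard]
      refine ⟨Finset.inter_subset_right, ?_⟩
      have : P ∩ T = (Q ∩ T) ∪ (P ∩ (T \ S)) := by grind
      have hd : Disjoint (Q ∩ T) (P ∩ (T \ S)) := by
        rw [Finset.disjoint_left]; grind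
      rw [← hP.1.2.2, this, Finset.card_union_of_disjoint hd]
      omega
    · intro P hP P' hP' h
      simp only [Finset.coe_filter, Finset.mem_filter, Set.mem_ofPred_eq] at hP hP'
      have h1 : P \ (T \ S) = P' \ (T \ S) := hP.2.trans hP'.2.symm
      rw [← Finset.sdiff_union_inter P (T \ S), h1, ← Finset.sdiff_union_inter P' (T \ S)]
      grind
  · intro Q hQ
    simp only [Finset.mem_image, Finset.mem_filter, Finset.mem_powerset] at hQ ⊢
    obtain ⟨P, ⟨hP, hx, -⟩, rfl⟩ := hQ
    refine ⟨Finset.sdiff_subset_sdiff hP le_rfl, ?_⟩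
    rw [← hx]
    congr 1
    grind

/-- The sign patterns (encoded by the set of positive coordinates) whose sum over `S` is not `0`. -/
def unbalancedOn {n : ℕ} (S : Finset (Fin n)) : Finset (Finset (Fin n)) :=
  Finset.univ.filter fun P => 2 * (P ∩ S).card ≠ S.card

theorem compl_unbalancedOn {n a : ℕ} {S : Finset (Fin n)} (hS : S.card = 2 * a) :
    (unbalancedOn S)ᶜ = Finset.univ.powerset.filter fun P => (P ∩ S).card = a := by
  ext P
  simp [unbalancedOn, hS]

theorem card_compl_unbalancedOn {n a : ℕ} {S : Finset (Fin n)} (hS : S.card = 2 * a) :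
    ((unbalancedOn S)ᶜ.card : ℝ) = 2 ^ n * maxAtom (2 * a) := by
  have hn : 2 * a ≤ n := by simpa [hS] using S.card_le_univ
  rw [compl_unbalancedOn hS, Finset.card_filter_card_inter_eq (Finset.subset_univ S), hS, maxAtom,
    Nat.mul_div_cancel_left a two_pos, Finset.card_univ, Fintype.card_fin]
  push_cast
  rw [pow_sub₀ _ two_ne_zero hn]
  field_simp

theorem card_unbalancedOn {n a : ℕ} {S : Finset (Fin n)} (hS : S.card = 2 * a) :
    ((unbalancedOn S).card : ℝ) = 2 ^ n * (1 - maxAtom (2 * a)) := by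
  have h := Finset.card_add_card_compl (unbalancedOn S)
  have h' : ((unbalancedOn S).card : ℝ) + (unbalancedOn S)ᶜ.card = 2 ^ n := by
    exact_mod_cast h.trans (by simp)
  rw [card_compl_unbalancedOn hS] at h'
  linarith

theorem card_unbalancedOn_inter_le {n a : ℕ} {S T : Finset (Fin n)} (hS : S.card = 2 * a)
    (hT : T.card = 2 * a) :
    ((unbalancedOn S ∩ unbalancedOn T).card : ℝ) ≤
      2 ^ n * (1 - 2 * maxAtom (2 * a) + maxAtom (2 * a) * maxAtom (T \ S).card) := by
  have hn : (T \ S).card + 2 * a ≤ n := by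
    rw [← hS, Finset.card_sdiff_add_card]
    simpa using (T ∪ S).card_le_univ
  have hbad : (((unbalancedOn S)ᶜ ∩ (unbalancedOn T)ᶜ).card : ℝ) ≤
      2 ^ n * (maxAtom (2 * a) * maxAtom (T \ S).card) := by
    have h := Finset.card_filter_card_inter_eq_and_le (Finset.subset_univ S)
      (Finset.subset_univ T) a a
    rw [compl_unbalancedOn hS, compl_unbalancedOn hT, ← Finset.filter_and]
    refine (Nat.cast_le.mpr h).trans (le_of_eq ?_)
    rw [hS, maxAtom, maxAtom, Nat.mul_div_cancel_left a two_pos, Finset.card_univ,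
      Fintype.card_fin, Nat.sub_sub]
    push_cast
    rw [pow_sub₀ _ two_ne_zero hn, pow_add]
    field_simp
  have h1 := Finset.card_add_card_compl (unbalancedOn S ∩ unbalancedOn T)
  have h2 := Finset.card_union_add_card_inter (unbalancedOn S)ᶜ (unbalancedOn T)ᶜ
  rw [Finset.compl_inter] at h1
  have h1' : ((unbalancedOn S ∩ unbalancedOn T).card : ℝ) +
      ((unbalancedOn S)ᶜ ∪ (unbalancedOn T)ᶜ).card = 2 ^ n := by
    exact_mod_cast h1.trans (by simp)
  have h2' : (((unbalancedOn S)ᶜ ∪ (unbalancedOn T)ᶜ).card : ℝ) +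
      ((unbalancedOn S)ᶜ ∩ (unbalancedOn T)ᶜ).card =
        (unbalancedOn S)ᶜ.card + (unbalancedOn T)ᶜ.card := by
    exact_mod_cast h2
  rw [card_compl_unbalancedOn hS, card_compl_unbalancedOn hT] at h2'
  linarith

/-- The second moment method for a finite family of finite sets. -/
theorem Finset.sq_sum_card_le_card_biUnion_mul {α ι : Type*} [DecidableEq α]
    (I : Finset ι) (G : ι → Finset α) :
    (∑ f ∈ I, ((G f).card : ℝ)) ^ 2 ≤
      (I.biUnion G).card * ∑ f ∈ I, ∑ g ∈ I, ((G f ∩ G g).card : ℝ) := by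
  have hcard (s : Finset α) (hs : s ⊆ I.biUnion G) :
      (s.card : ℝ) = ∑ x ∈ I.biUnion G, if x ∈ s then 1 else 0 := by
    rw [Finset.sum_ite_mem, Finset.inter_eq_right.mpr hs]
    simp
  have h1 : ∑ f ∈ I, ((G f).card : ℝ) =
      ∑ x ∈ I.biUnion G, ∑ f ∈ I, if x ∈ G f then 1 else 0 := by
    rw [Finset.sum_comm]
    exact Finset.sum_congr rfl fun f hf => hcard _ (Finset.subset_biUnion_of_mem G hf)
  have h2 : ∑ f ∈ I, ∑ g ∈ I, ((G f ∩ G g).card : ℝ) =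
      ∑ x ∈ I.biUnion G, (∑ f ∈ I, if x ∈ G f then 1 else 0) ^ 2 := by
    simp_rw [sq, Finset.sum_mul_sum]
    rw [Finset.sum_comm (s := I.biUnion G)]
    refine Finset.sum_congr rfl fun f hf => ?_
    rw [Finset.sum_comm]
    refine Finset.sum_congr rfl fun g _ => ?_
    rw [hcard _ (Finset.inter_subset_left.trans (Finset.subset_biUnion_of_mem G hf))]
    refine Finset.sum_congr rfl fun x _ => ?_
    by_cases h : x ∈ G f <;> by_cases h' : x ∈ G g <;> simp [h, h']
  rw [h1, h2]
  exact sq_sum_le_card_mul_sum_sq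

/-- The exponential moment of the number of agreements of two independent uniform functions. -/
theorem sum_sum_exp_card_agree_le (ℓ N : ℕ) (hN : 0 < N) (t : ℝ) :
    ∑ f : Fin ℓ → Fin N, ∑ g : Fin ℓ → Fin N,
        Real.exp (t * (Finset.univ.filter fun i => f i = g i).card) ≤
      ((N : ℝ) ^ ℓ) ^ 2 * Real.exp (ℓ * (Real.exp t - 1) / N) := by
  have hprod (f g : Fin ℓ → Fin N) :
      Real.exp (t * (Finset.univ.filter fun i => f i = g i).card) =
        ∏ i, if f i = g i then Real.exp t else 1 := by
    rw [Finset.prod_ite]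
    simp [← Real.exp_nat_mul, mul_comm]
  have hrow (f : Fin ℓ → Fin N) :
      ∑ g : Fin ℓ → Fin N, Real.exp (t * (Finset.univ.filter fun i => f i = g i).card) =
        (N + (Real.exp t - 1)) ^ ℓ := by
    simp_rw [hprod]
    rw [← Fintype.prod_sum (fun i b => if f i = b then Real.exp t else 1)]
    have (i : Fin ℓ) : ∑ b, (if f i = b then Real.exp t else 1) = N + (Real.exp t - 1) := by
      have : ∀ b, (if f i = b then Real.exp t else 1) =
          1 + if f i = b then Real.exp t - 1 else 0 := by intro b; split_ifs <;> ring
      simp_rw [this, Finset.sum_add_distrib]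
      simp
    simp [this]
  simp_rw [hrow]
  have hN' : (0 : ℝ) < N := by exact_mod_cast hN
  have hN1 : (1 : ℝ) ≤ N := by exact_mod_cast hN
  have hfac : (N : ℝ) + (Real.exp t - 1) = N * (1 + (Real.exp t - 1) / N) := by field_simp
  have hpos : 0 ≤ 1 + (Real.exp t - 1) / N := by
    have : 0 < (N : ℝ) * (1 + (Real.exp t - 1) / N) := by
      rw [← hfac]; linarith [Real.exp_pos t]
    exact (pos_of_mul_pos_right this hN'.le).le
  have hexp : (1 + (Real.exp t - 1) / N) ^ ℓ ≤ Real.exp (ℓ * (Real.exp t - 1) / N) := by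
    rw [mul_div_assoc, Real.exp_nat_mul]
    exact pow_le_pow_left₀ hpos (by linarith [Real.add_one_le_exp ((Real.exp t - 1) / N)]) ℓ
  simp only [Finset.sum_const, Finset.card_univ, Fintype.card_fun, Fintype.card_fin, nsmul_eq_mul]
  push_cast
  rw [hfac, mul_pow, sq, mul_assoc]
  gcongr

/-- One step of the second moment bound, when the two supports share few coordinates. -/
theorem joint_pow_le_of_agree_le {a t m : ℕ} (ha : 2 ≤ a) (ht : t ≤ a) :
    (1 - 2 * maxAtom (2 * a) + maxAtom (2 * a) * maxAtom (2 * a - t)) ^ m ≤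
      ((1 - maxAtom (2 * a)) ^ m) ^ 2 * Real.exp (2 * m / a ^ 2 * t) := by
  have hq0 := maxAtom_pos (2 * a)
  have hq := maxAtom_two_mul_sq_le a
  have hp0 := maxAtom_pos (2 * a - t)
  have hp := mul_maxAtom_le (Nat.sub_le (2 * a) t)
  rw [Nat.cast_sub (by omega)] at hp
  push_cast at hp
  generalize maxAtom (2 * a) = q at *
  generalize maxAtom (2 * a - t) = p at *
  have ha' : (2 : ℝ) ≤ a := by exact_mod_cast ha
  have ht' : (t : ℝ) ≤ a := by exact_mod_cast ht
  have ht0 : (0 : ℝ) ≤ t := by positivity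
  have hq2 : q ≤ 1 / 2 := by nlinarith
  have hpq : (a : ℝ) * (p - q) ≤ t * q := by
    rcases le_total p q with h | h <;> nlinarith
  have hdiff : q * p - q ^ 2 ≤ (1 - q) ^ 2 * (2 * t / a ^ 2) := by
    rw [mul_div_assoc', le_div_iff₀ (by positivity)]
    have h1 : (q * p - q ^ 2) * a ^ 2 ≤ a * t * q ^ 2 := by
      have := mul_le_mul_of_nonneg_left hpq (show 0 ≤ a * q by positivity)
      linarith
    have h2 : a * t * q ^ 2 ≤ t / 2 := by nlinarith
    have h3 : (t : ℝ) / 2 ≤ (1 - q) ^ 2 * (2 * t) := by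
      have : (1 : ℝ) / 4 ≤ (1 - q) ^ 2 := by nlinarith
      nlinarith
    linarith
  have hstep : 1 - 2 * q + q * p ≤ (1 - q) ^ 2 * Real.exp (2 * t / a ^ 2) := by
    have := mul_le_mul_of_nonneg_left (Real.add_one_le_exp (2 * (t : ℝ) / a ^ 2))
      (sq_nonneg (1 - q))
    nlinarith
  refine (pow_le_pow_left₀ (by nlinarith) hstep m).trans (le_of_eq ?_)
  rw [mul_pow, ← Real.exp_nat_mul, ← pow_mul, ← pow_mul, mul_comm 2 m]
  congr 2
  ring

/-- One step of the second moment bound, when the two supports share many coordinates. -/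
theorem joint_pow_le_of_le_agree {a t m : ℕ} (ha : 2 ≤ a) (ht : a ≤ t) (hm : 2 * m ^ 2 ≤ a ^ 3) :
    (1 - 2 * maxAtom (2 * a) + maxAtom (2 * a) * maxAtom (2 * a - t)) ^ m ≤
      ((1 - maxAtom (2 * a)) ^ m) ^ 2 * (Real.exp (3 * t) * Real.exp (-(2 * a))) := by
  have hq0 := maxAtom_pos (2 * a)
  have hq := maxAtom_two_mul_sq_le a
  have hp0 := maxAtom_pos (2 * a - t)
  have hp1 := maxAtom_le_one (2 * a - t)
  generalize maxAtom (2 * a) = q at *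
  generalize maxAtom (2 * a - t) = p at *
  have ha' : (2 : ℝ) ≤ a := by exact_mod_cast ha
  have ht' : (a : ℝ) ≤ t := by exact_mod_cast ht
  have hm' : 2 * (m : ℝ) ^ 2 ≤ a ^ 3 := by exact_mod_cast hm
  have hq2 : q ≤ 1 / 2 := by nlinarith
  have hmq : 2 * m * q ≤ a := by
    refine le_of_sq_le_sq ?_ (by positivity)
    have : (2 * m * q) ^ 2 * a ≤ a ^ 2 * a := by
      have h1 : 2 * a * q ^ 2 ≤ 1 := by nlinarith
      have h2 : 2 * (m : ℝ) ^ 2 * (2 * a * q ^ 2) ≤ 2 * m ^ 2 * 1 := by gcongr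
      nlinarith
    exact le_of_mul_le_mul_right this (by linarith)
  have hstep : 1 - 2 * q + q * p ≤ (1 - q) ^ 2 * Real.exp (2 * q) := by
    have h1 := Real.add_one_le_exp (2 * q)
    have h2 : 1 ≤ (1 - q) * Real.exp (2 * q) := by nlinarith
    nlinarith
  refine (pow_le_pow_left₀ (by nlinarith) hstep m).trans ?_
  rw [mul_pow, ← Real.exp_nat_mul, ← pow_mul, ← pow_mul, mul_comm 2 m, ← Real.exp_add]
  refine mul_le_mul_of_nonneg_left (Real.exp_le_exp.mpr (by linarith)) (pow_nonneg ?_ _)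
  linarith

/-- Many supports of size `2 * a`, one for each choice of a column from each of `2 * a` blocks. -/
theorem exists_transversal_family {n a N : ℕ} (h : 2 * a * N ≤ n) :
    ∃ S : (Fin (2 * a) → Fin N) → Finset (Fin n), (∀ f, (S f).card = 2 * a) ∧
      ∀ f g, (S g \ S f).card = 2 * a - (Finset.univ.filter fun i => f i = g i).card := by
  obtain ⟨e⟩ : Nonempty (Fin (2 * a) × Fin N ↪ Fin n) :=
    Function.Embedding.nonempty_of_card_le (by simpa using h)
  have hinj (f : Fin (2 * a) → Fin N) : Function.Injective fun i => e (i, f i) := by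
    intro i j hij
    simpa using congrArg Prod.fst (e.injective hij)
  refine ⟨fun f => Finset.univ.image fun i => e (i, f i), fun f => ?_, fun f g => ?_⟩
  · rw [Finset.card_image_of_injective _ (hinj f)]
    simp
  · have : (Finset.univ.image fun i => e (i, g i)) \ (Finset.univ.image fun i => e (i, f i)) =
        (Finset.univ.filter fun i => f i = g i)ᶜ.image fun i => e (i, g i) := by
      ext x
      simp only [Finset.mem_sdiff, Finset.mem_image, Finset.mem_univ, true_and,
        Finset.mem_compl, Finset.mem_filter]
      constructor
      · rintro ⟨⟨i, rfl⟩, hi⟩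
        exact ⟨i, fun h => hi ⟨i, by rw [h]⟩, rfl⟩
      · rintro ⟨i, hi, rfl⟩
        refine ⟨⟨i, rfl⟩, ?_⟩
        rintro ⟨j, hj⟩
        have := e.injective hj
        simp only [Prod.mk.injEq] at this
        obtain ⟨rfl, h⟩ := this
        exact hi h
    rw [this, Finset.card_image_of_injective _ (hinj g), Finset.card_compl, Fintype.card_fin]

/-- At least half of the sign matrices (each row encoded by its set of positive entries) admit a
column set of size `2 * a` on which no row sums to zero. -/
theorem exists_many_unbalanced {n m a N : ℕ} (ha : 2 ≤ a) (hN : 42 ≤ N) (hn : 2 * a * N ≤ n)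
    (hm : 2 * m ^ 2 ≤ a ^ 3) (hmN : 32 * m ≤ a * N) :
    ∃ U : Finset (Fin m → Finset (Fin n)), ((2 : ℝ) ^ n) ^ m ≤ 2 * U.card ∧
      ∀ ω ∈ U, ∃ S : Finset (Fin n), S.card = 2 * a ∧ ∀ i, 2 * (ω i ∩ S).card ≠ S.card := by
  obtain ⟨S, hS, hST⟩ := exists_transversal_family hn
  let G (f : Fin (2 * a) → Fin N) : Finset (Fin m → Finset (Fin n)) :=
    Fintype.piFinset fun _ => unbalancedOn (S f)
  refine ⟨Finset.univ.biUnion G, ?_, fun ω hω => ?_⟩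
  swap
  · obtain ⟨f, -, hf⟩ := Finset.mem_biUnion.mp hω
    refine ⟨S f, hS f, fun i => ?_⟩
    simpa [unbalancedOn] using Fintype.mem_piFinset.mp hf i
  have hq0 := maxAtom_pos (2 * a)
  have ha' : (2 : ℝ) ≤ a := by exact_mod_cast ha
  have hN' : (42 : ℝ) ≤ N := by exact_mod_cast hN
  have hq1 : maxAtom (2 * a) < 1 := by nlinarith [maxAtom_two_mul_sq_le a]
  have hm1 : 2 * (m : ℝ) / a ^ 2 ≤ 1 := by
    rw [div_le_one (by positivity)]
    have h : 2 * (m : ℝ) ^ 2 ≤ a ^ 3 := by exact_mod_cast hm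
    refine le_of_sq_le_sq ?_ (by positivity)
    have : (0 : ℝ) ≤ a ^ 3 := by positivity
    nlinarith
  have hmN' : 32 * (m : ℝ) ≤ a * N := by exact_mod_cast hmN
  set q := maxAtom (2 * a)
  set M : ℝ := (2 ^ n) ^ m
  set lam : ℝ := 2 * m / a ^ 2 with hlam
  have hM0 : 0 < M := by positivity
  have hfirst : ∑ f, ((G f).card : ℝ) = N ^ (2 * a) * (M * (1 - q) ^ m) := by
    have hG (f : Fin (2 * a) → Fin N) : ((G f).card : ℝ) = M * (1 - q) ^ m := by
      simp only [G, Fintype.card_piFinset, Finset.prod_const, Finset.card_univ, Fintype.card_fin]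
      push_cast
      rw [card_unbalancedOn (hS f), mul_pow]
    simp [hG]
  have hpair (f g : Fin (2 * a) → Fin N) : ((G f ∩ G g).card : ℝ) ≤ M * ((1 - q) ^ m) ^ 2 *
      (Real.exp (lam * (Finset.univ.filter fun i => f i = g i).card) +
        Real.exp (3 * (Finset.univ.filter fun i => f i = g i).card) * Real.exp (-(2 * a))) := by
    have hinter : G f ∩ G g =
        Fintype.piFinset fun _ => unbalancedOn (S f) ∩ unbalancedOn (S g) := by
      ext ω
      simp [G, forall_and]
    have hle := card_unbalancedOn_inter_le (hS f) (hS g)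
    rw [hST] at hle
    set t := (Finset.univ.filter fun i => f i = g i).card
    rw [hinter, Fintype.card_piFinset, Finset.prod_const, Finset.card_univ, Fintype.card_fin,
      Nat.cast_pow]
    refine (pow_le_pow_left₀ (by positivity) hle m).trans ?_
    rw [mul_pow, mul_assoc]
    refine mul_le_mul_of_nonneg_left ?_ hM0.le
    rw [mul_add]
    rcases le_total t a with ht | ht
    · exact (joint_pow_le_of_agree_le ha ht).trans (le_add_of_nonneg_right (by positivity))
    · exact (joint_pow_le_of_le_agree ha ht hm).trans (le_add_of_nonneg_left (by positivity))
  have hsecond : ∑ f, ∑ g, ((G f ∩ G g).card : ℝ) ≤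
      M * ((1 - q) ^ m) ^ 2 * (((N : ℝ) ^ (2 * a)) ^ 2 * 2) := by
    refine (Finset.sum_le_sum fun f _ => Finset.sum_le_sum fun g _ => hpair f g).trans ?_
    simp_rw [← Finset.mul_sum, Finset.sum_add_distrib, ← Finset.sum_mul]
    refine mul_le_mul_of_nonneg_left ?_ (by positivity)
    have h1 := sum_sum_exp_card_agree_le (2 * a) N (by omega) lam
    have h2 := mul_le_mul_of_nonneg_right (sum_sum_exp_card_agree_le (2 * a) N (by omega) 3)
      (Real.exp_pos (-(2 * a))).le
    refine (add_le_add h1 h2).trans ?_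
    rw [mul_assoc, ← mul_add, ← Real.exp_add]
    refine mul_le_mul_of_nonneg_left ?_ (by positivity)
    push_cast
    have he3 : Real.exp 3 ≤ 21 := by
      have : Real.exp 3 = Real.exp 1 ^ 3 := by rw [← Real.exp_nat_mul]; norm_num
      rw [this]
      refine (pow_le_pow_left₀ (Real.exp_pos 1).le Real.exp_one_lt_d9.le 3).trans ?_
      norm_num
    have hlam0 : 0 ≤ lam := by positivity
    have helam : Real.exp lam - 1 ≤ 2 * lam := by
      have := Real.abs_exp_sub_one_le (x := lam) (by rwa [abs_of_nonneg hlam0])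
      rwa [abs_of_nonneg hlam0, abs_of_nonneg (by linarith [Real.add_one_le_exp lam])] at this
    have hx : 2 * a * (Real.exp lam - 1) / N ≤ 1 / 4 := by
      rw [div_le_iff₀ (by linarith)]
      have : 2 * a * (Real.exp lam - 1) ≤ 2 * a * (2 * lam) := by gcongr
      have h3 : (a : ℝ) * (2 * a * (2 * lam)) = 8 * m := by rw [hlam]; field_simp; ring
      have h4 : (a : ℝ) * (2 * a * (2 * lam)) ≤ a * (1 / 4 * N) := by rw [h3]; linarith
      exact this.trans (le_of_mul_le_mul_left h4 (by linarith))
    have hy : 2 * a * (Real.exp 3 - 1) / N + -(2 * a) ≤ -1 := by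
      have : 2 * a * (Real.exp 3 - 1) / N ≤ a := by
        rw [div_le_iff₀ (by linarith)]
        nlinarith
      linarith
    have hex : Real.exp (2 * a * (Real.exp lam - 1) / N) ≤ 3 / 2 := by
      refine (Real.exp_le_exp.mpr hx).trans ?_
      have := Real.abs_exp_sub_one_le (x := 1 / 4) (by norm_num [abs_of_pos])
      rw [abs_le, abs_of_pos (by norm_num : (0 : ℝ) < 1 / 4)] at this
      linarith
    have hey : Real.exp (2 * a * (Real.exp 3 - 1) / N + -(2 * a)) ≤ 1 / 2 := by
      refine (Real.exp_le_exp.mpr hy).trans ?_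
      rw [Real.exp_neg, one_div]
      exact inv_anti₀ two_pos (by linarith [Real.add_one_le_exp (1 : ℝ)])
    linarith
  have hcs := Finset.sq_sum_card_le_card_biUnion_mul Finset.univ G
  rw [hfirst] at hcs
  have hcs' := hcs.trans (mul_le_mul_of_nonneg_left hsecond (Nat.cast_nonneg _))
  have hpos : 0 < M * ((1 - q) ^ m) ^ 2 * ((N : ℝ) ^ (2 * a)) ^ 2 := by
    have : 0 < 1 - q := by linarith
    have : (0 : ℝ) < N := by linarith
    positivity
  refine le_of_mul_le_mul_right ?_ hpos
  linarith

/-- The `±1` matrix whose `i`-th row is positive exactly on `ω i`. -/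
noncomputable def signMatrix {m n : ℕ} (ω : Fin m → Finset (Fin n)) : Fin m → Fin n → ℝ :=
  fun i j => if j ∈ ω i then 1 else -1

theorem signMatrix_injective (m n : ℕ) : Function.Injective (signMatrix (m := m) (n := n)) := by
  intro ω ω' h
  ext i j
  have := congrFun (congrFun h i) j
  by_cases h1 : j ∈ ω i <;> by_cases h2 : j ∈ ω' i <;> simp [signMatrix, h1, h2] at this ⊢ <;>
    norm_num at this

theorem radMat_singleton_signMatrix {m n : ℕ} (ω : Fin m → Finset (Fin n)) :
    radMat m n {signMatrix ω} = ((2 ^ n) ^ m)⁻¹ := by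
  have hentry (i : Fin m) (j : Fin n) : rademacherMeas {signMatrix ω i j} = 2⁻¹ := by
    have h1 : ¬ ((-1 : ℝ) = 1) := by norm_num
    have h2 : ¬ ((1 : ℝ) = -1) := by norm_num
    by_cases h : j ∈ ω i <;> simp [rademacherMeas, signMatrix, h, h1, h2]
  have hrow (i : Fin m) : radVec n {signMatrix ω i} = (2 ^ n)⁻¹ := by
    rw [radVec, Measure.pi_singleton]
    simp [hentry, ENNReal.inv_pow]
  have : SigmaFinite (radVec n) := by unfold radVec; infer_instance
  rw [radMat, Measure.pi_singleton]
  simp [hrow, ENNReal.inv_pow]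

theorem sum_signMatrix {m n : ℕ} (ω : Fin m → Finset (Fin n)) (S : Finset (Fin n)) (i : Fin m) :
    ∑ j ∈ S, signMatrix ω i j = 2 * (ω i ∩ S).card - S.card := by
  have : ∀ j, signMatrix ω i j = 2 * (if j ∈ ω i then 1 else 0) - 1 := by
    intro j
    simp only [signMatrix]
    split_ifs <;> norm_num
  simp_rw [this, Finset.sum_sub_distrib, ← Finset.mul_sum, Finset.sum_ite_mem]
  simp [Finset.inter_comm]

theorem indicator_one_mem_sparseDR {n k : ℕ} {S : Finset (Fin n)} (hS : S.card ≤ k) :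
    (fun j => if j ∈ S then (1 : ℝ) else 0) ∈ sparseDR n k 1 := by
  refine ⟨by simpa using hS, fun i j hi hj => ?_⟩
  simp only [ne_eq, ite_eq_right_iff, one_ne_zero, imp_false, not_not] at hi hj
  simp [hi, hj]

/-- If no row of a sign matrix sums to zero over an even-size column set, adding a further column
to this set changes no measurement. -/
theorem not_validMeas_signMatrix {m n k a : ℕ} {ω : Fin m → Finset (Fin n)}
    {S : Finset (Fin n)} (hS : S.card = 2 * a) (hω : ∀ i, 2 * (ω i ∩ S).card ≠ S.card)
    (hk : 2 * a < k) (hn : 2 * a < n) : ¬ ValidMeas m n k 1 (signMatrix ω) := by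
  obtain ⟨x, hx⟩ : ∃ x, x ∉ S := by
    by_contra! h
    have := Finset.eq_univ_iff_forall.mpr h
    rw [this, Finset.card_univ, Fintype.card_fin] at hS
    omega
  intro hvalid
  have hsum (T : Finset (Fin n)) (i : Fin m) :
      ∑ j, signMatrix ω i j * (if j ∈ T then (1 : ℝ) else 0) = ∑ j ∈ T, signMatrix ω i j := by
    simp
  refine hvalid _ (indicator_one_mem_sparseDR (S := S) (by omega)) _
    (indicator_one_mem_sparseDR (S := insert x S) (by rw [Finset.card_insert_of_notMem hx]; omega))
    (fun h => ?_) (funext fun i => ?_)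
  · have := Set.ext_iff.mp h x
    simp [hx] at this
  · simp only [hsum]
    rw [Finset.sum_insert hx, sum_signMatrix, hS]
    have hab : |signMatrix ω i x| ≤ 1 := by
      unfold signMatrix
      split_ifs <;> simp
    rw [abs_le] at hab
    have hne := hω i
    rw [hS] at hne
    rcases lt_or_gt_of_ne (show (ω i ∩ S).card ≠ a by omega) with h | h
    · have h' : ((ω i ∩ S).card : ℝ) + 1 ≤ a := by exact_mod_cast h
      push_cast
      rw [sgn, sgn, if_neg (by linarith), if_neg (by linarith)]
    · have h' : (a : ℝ) + 1 ≤ (ω i ∩ S).card := by exact_mod_cast h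
      push_cast
      rw [sgn, sgn, if_pos (by linarith), if_pos (by linarith)]

theorem half_le_radMat_not_validMeas {n m k a N : ℕ} (ha : 2 ≤ a) (hN : 42 ≤ N)
    (hn : 2 * a * N ≤ n) (hm : 2 * m ^ 2 ≤ a ^ 3) (hmN : 32 * m ≤ a * N) (hk : 2 * a < k) :
    1 / 2 ≤ radMat m n {A | ¬ ValidMeas m n k 1 A} := by
  obtain ⟨U, hU, hUS⟩ := exists_many_unbalanced ha hN hn hm hmN
  have hsub : ((U.map ⟨signMatrix, signMatrix_injective m n⟩ : Finset _) :
      Set (Fin m → Fin n → ℝ)) ⊆ {A | ¬ ValidMeas m n k 1 A} := by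
    intro A hA
    obtain ⟨ω, hω, rfl⟩ := Finset.mem_map.mp (Finset.mem_coe.mp hA)
    obtain ⟨S, hS, hne⟩ := hUS ω hω
    exact not_validMeas_signMatrix hS hne hk (by nlinarith)
  refine le_trans ?_ (measure_mono hsub)
  rw [← sum_measure_singleton, Finset.sum_map]
  simp only [Function.Embedding.coeFn_mk, radMat_singleton_signMatrix, Finset.sum_const,
    nsmul_eq_mul]
  have hU' : (2 ^ n) ^ m ≤ 2 * U.card := by exact_mod_cast hU
  rw [← div_eq_mul_inv, ENNReal.le_div_iff_mul_le (by simp) (by simp), one_div,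
    ENNReal.inv_mul_le_iff (by simp) (by simp)]
  exact_mod_cast hU'

/-- with `m ≤ c·k^{1.5}` measurements, an i.i.d. Rademacher matrix fails to
be a valid universal 1-bit measurement matrix for support recovery on `X_k(1)` with
probability at least `1/2`. -/
theorem rademacher_lower_bound (ε : ℝ) (hε1 : 0 < ε) (hε2 : ε < 2/3) :
    ∃ c : ℝ, 0 < c ∧ ∃ K : ℕ, ∀ k n m : ℕ, K ≤ k → K ≤ n →
      (k : ℝ) ≤ (n : ℝ) ^ ((2:ℝ)/3 - ε) →
      (m : ℝ) ≤ c * (k : ℝ) ^ (1.5:ℝ) →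
      radMat m n {A | ¬ ValidMeas m n k 1 A} ≥ 1/2 := by
  refine ⟨1 / 128, by norm_num, 100000, fun k n m hKk hKn hkn hmk => ?_⟩
  have hk : (100000 : ℝ) ≤ k := by exact_mod_cast hKk
  have hn : (100000 : ℝ) ≤ n := by exact_mod_cast hKn
  have hk3 : (k : ℝ) ^ 3 ≤ n ^ 2 := by
    have h : (k : ℝ) ≤ (n : ℝ) ^ ((2 : ℝ) / 3) :=
      hkn.trans (Real.rpow_le_rpow_of_exponent_le (by linarith) (by linarith))
    refine (pow_le_pow_left₀ (by positivity) h 3).trans (le_of_eq ?_)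
    rw [← Real.rpow_natCast, ← Real.rpow_mul (by positivity), ← Real.rpow_natCast]
    norm_num
  have hm2 : (128 * m : ℝ) ^ 2 ≤ k ^ 3 := by
    have h : 128 * (m : ℝ) ≤ (k : ℝ) ^ (1.5 : ℝ) := by linarith
    refine (pow_le_pow_left₀ (by positivity) h 2).trans (le_of_eq ?_)
    rw [← Real.rpow_natCast, ← Real.rpow_mul (by positivity), ← Real.rpow_natCast]
    norm_num
  have hmn : 128 * m ≤ n := by
    have : (128 * m : ℝ) ≤ n := le_of_sq_le_sq (hm2.trans hk3) (by positivity)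
    exact_mod_cast this
  have hkn' : 43 * k ≤ n := by
    have : (43 * k : ℝ) ≤ n := by
      by_contra! h
      have h2 : (n : ℝ) ^ 2 < (43 * k) ^ 2 := by gcongr
      nlinarith [sq_nonneg (k : ℝ)]
    exact_mod_cast this
  have hm2' : (128 * m) ^ 2 ≤ k ^ 3 := by exact_mod_cast hm2
  obtain ⟨a, hak, hka⟩ : ∃ a, 2 * a < k ∧ k ≤ 2 * a + 2 := ⟨(k - 1) / 2, by omega, by omega⟩
  have ha : 0 < 2 * a := by omega
  have hdiv := Nat.div_mul_le_self n (2 * a)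
  have hmod := Nat.lt_div_mul_add (a := n) ha
  refine half_le_radMat_not_validMeas (a := a) (N := n / (2 * a)) (by omega) ?_ ?_ ?_ ?_ hak
  · rw [Nat.le_div_iff_mul_le ha]
    omega
  · rwa [mul_comm]
  · have : k ^ 3 ≤ (4 * a) ^ 3 := Nat.pow_le_pow_left (by omega) 3
    have : (4 * a) ^ 3 = 64 * a ^ 3 := by ring
    have : (128 * m) ^ 2 = 16384 * m ^ 2 := by ring
    omega
  · have : n / (2 * a) * (2 * a) = 2 * (a * (n / (2 * a))) := by ring
    omega
end

section
/- Let n, k, m be positive integers with 2 ≤ k and k + 1 ≤ n. If A ∈ {−1, +1}^(m×n) is a valid universal 1-bit measurement matrix for support recovery on X_k(1), then the set of row vectors of A is (n, k − 1, 1)-balanced. -/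
open MeasureTheory ProbabilityTheory
open scoped NNReal ENNReal

/-- Indicator vectors of sets of size at most `k` lie in `X_k(1)`. -/
theorem indicator_mem_sparseDR {n k : ℕ} (S : Finset (Fin n)) (hS : S.card ≤ k) :
    (fun j => if j ∈ S then (1 : ℝ) else 0) ∈ sparseDR n k 1 := by
  refine ⟨by simpa using hS, fun i j hi hj => ?_⟩
  have hi' : i ∈ S := by simpa using hi
  have hj' : j ∈ S := by simpa using hj
  simp [hi', hj']

/-- A perturbation of size at most `1` does not change the sign of a number of
magnitude greater than `1`. -/
theorem sgn_add_eq_of_one_lt_abs {s a : ℝ} (hs : 1 < |s|) (ha : |a| ≤ 1) :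
    sgn (a + s) = sgn s := by
  obtain ⟨ha₁, ha₂⟩ := abs_le.mp ha
  unfold sgn
  rcases lt_abs.mp hs with h | h
  · rw [if_pos (by linarith), if_pos (by linarith)]
  · rw [if_neg (by linarith), if_neg (by linarith)]

/-- if a `±1`-valued matrix `A` is a valid universal 1-bit measurement
matrix for support recovery on `X_k(1)`, then its set of rows is `(n, k−1, 1)`-balanced. -/
theorem rademacher_valid_implies_balanced (n k m : ℕ) (hk : 2 ≤ k) (hkn : k + 1 ≤ n)
    (hm : 0 < m) (A : Fin m → Fin n → ℝ) (hpm : ∀ i j, A i j = 1 ∨ A i j = -1)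
    (hA : ValidMeas m n k 1 A) :
    IsBalanced n (k - 1) 1 {w | ∃ i : Fin m, w = A i} := by
  intro S hS
  obtain ⟨a, ha⟩ : ∃ a, a ∉ S := by
    by_contra! h
    have hcard : S.card = n := by simp [Finset.eq_univ_of_forall h]
    omega
  by_contra! hbig
  refine hA _ (indicator_mem_sparseDR (insert a S) ?_) _ (indicator_mem_sparseDR S ?_) ?_ ?_
  · rw [Finset.card_insert_of_notMem ha]
    omega
  · omega
  · intro h
    have ha' := Set.ext_iff.mp h a
    simp [ha] at ha'
  · funext i
    have hai : |A i a| ≤ 1 := by rcases hpm i a with h | h <;> simp [h]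
    simp only [mul_ite, mul_one, mul_zero, Finset.sum_ite_mem, Finset.univ_inter,
      Finset.sum_insert ha]
    exact sgn_add_eq_of_one_lt_abs (hbig (A i) ⟨i, rfl⟩) hai
end

section
/- Fix ε ∈ (0, 2/3). There exists a constant c > 0 such that for all sufficiently large even integers k and all n with k ≤ n^(2/3 − ε) and all m with m ≤ c·k^1.5, the following holds: if V ⊆ {−1, +1}^n is a set of m random vectors, each drawn independently with i.i.d. Rademacher entries (each coordinate equal to +1 with probability 1/2 and −1 with probability 1/2), then with probability at least 1/2 the set V is not (n, k, 1)-balanced. -/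
open MeasureTheory ProbabilityTheory
open scoped NNReal ENNReal

/-! ### Central binomial probabilities -/

/-- The probability that a sum of `2 * r` independent signs vanishes. -/
noncomputable def centralProb (r : ℕ) : ℝ := (Nat.centralBinom r : ℝ) / 4 ^ r

lemma centralProb_nonneg (r : ℕ) : 0 ≤ centralProb r := by
  unfold centralProb; positivity

lemma centralProb_succ (r : ℕ) :
    centralProb (r + 1) = centralProb r * (1 - 1 / (2 * ((r : ℝ) + 1))) := by
  have h : ((r : ℝ) + 1) * Nat.centralBinom (r + 1) = 2 * (2 * r + 1) * Nat.centralBinom r := by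
    exact_mod_cast Nat.succ_mul_centralBinom_succ r
  have hr : (r : ℝ) + 1 ≠ 0 := by positivity
  have h' : (Nat.centralBinom (r + 1) : ℝ)
      = 2 * (2 * r + 1) * Nat.centralBinom r / ((r : ℝ) + 1) := by
    rw [← h]; field_simp
  unfold centralProb
  rw [h', pow_succ]
  field_simp
  ring

lemma centralProb_antitone : Antitone centralProb := by
  refine antitone_nat_of_succ_le fun r => ?_
  rw [centralProb_succ]
  have h : 0 ≤ 1 / (2 * ((r : ℝ) + 1)) := by positivity
  nlinarith [centralProb_nonneg r]

lemma centralProb_le_half {r : ℕ} (hr : 1 ≤ r) : centralProb r ≤ 1 / 2 := by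
  have h : centralProb 1 = 1 / 2 := by norm_num [centralProb, Nat.centralBinom]
  exact h ▸ centralProb_antitone hr

lemma centralProb_le_one (r : ℕ) : centralProb r ≤ 1 := by
  have h : centralProb 0 = 1 := by norm_num [centralProb]
  exact h ▸ centralProb_antitone r.zero_le

lemma centralProb_sq_mul_le (r : ℕ) : centralProb r ^ 2 * (2 * r + 1) ≤ 1 := by
  induction r with
  | zero => norm_num [centralProb]
  | succ r ih =>
    refine le_trans ?_ ih
    rw [centralProb_succ, mul_pow, mul_assoc]
    refine mul_le_mul_of_nonneg_left ?_ (sq_nonneg _)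
    push_cast
    have hr : (0 : ℝ) < (r : ℝ) + 1 := by positivity
    have h : 1 - 1 / (2 * ((r : ℝ) + 1)) = (2 * r + 1) / (2 * (r + 1)) := by
      field_simp; ring
    rw [h, div_pow, div_mul_eq_mul_div, div_le_iff₀ (by positivity)]
    nlinarith [Nat.cast_nonneg (α := ℝ) r]

lemma centralProb_le_inv_sqrt (r : ℕ) : centralProb r ≤ 1 / √(2 * r + 1) := by
  have h0 : (0 : ℝ) < 2 * r + 1 := by positivity
  rw [le_div_iff₀ (Real.sqrt_pos.2 h0)]
  have h := centralProb_sq_mul_le r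
  refine abs_le_one_iff_mul_self_le_one.2 ?_ |> (le_abs_self _).trans
  calc _ = centralProb r ^ 2 * (√(2 * r + 1) * √(2 * r + 1)) := by ring
    _ ≤ 1 := by rwa [Real.mul_self_sqrt h0.le]

lemma centralProb_sub_le {r s : ℕ} (hr : 1 ≤ r) (hs : 2 * s ≤ r) :
    centralProb (r - s) - centralProb r ≤ s / (r * √r) := by
  induction s with
  | zero => simp
  | succ s ih =>
    have ih := ih (by omega)
    obtain ⟨j, hj⟩ : ∃ j, r - s = j + 1 := ⟨r - s - 1, by omega⟩
    have hj' : r - (s + 1) = j := by omega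
    rw [hj, centralProb_succ] at ih
    rw [hj']
    have hr0 : (0 : ℝ) < r := by exact_mod_cast hr
    have hrj : (r : ℝ) ≤ 2 * j + 1 := by exact_mod_cast (by omega : r ≤ 2 * j + 1)
    have hrj' : (r : ℝ) ≤ 2 * (j + 1) := by linarith
    have h1 : centralProb j ≤ 1 / √r :=
      (centralProb_le_inv_sqrt j).trans
        (one_div_le_one_div_of_le (Real.sqrt_pos.2 hr0) (Real.sqrt_le_sqrt hrj))
    have h2 : centralProb j * (1 / (2 * ((j : ℝ) + 1))) ≤ 1 / √r * (1 / r) :=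
      mul_le_mul h1 (one_div_le_one_div_of_le hr0 hrj') (by positivity) (by positivity)
    have h3 : ((s + 1 : ℕ) : ℝ) / (r * √r) = s / (r * √r) + 1 / √r * (1 / r) := by
      have := Real.sqrt_pos.2 hr0
      push_cast
      field_simp
    rw [h3]
    linarith

lemma choose_half_eq_centralProb (u : ℕ) :
    (Nat.choose u (u / 2) : ℝ) / 2 ^ u = centralProb ((u + 1) / 2) := by
  obtain ⟨a, rfl | rfl⟩ := Nat.even_or_odd' u
  · have h1 : 2 * a / 2 = a := by omega
    have h2 : (2 * a + 1) / 2 = a := by omega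
    rw [h1, h2, centralProb, Nat.centralBinom, pow_mul]
    norm_num
  · have h1 : (2 * a + 1) / 2 = a := by omega
    have h2 : (2 * a + 1 + 1) / 2 = a + 1 := by omega
    have h3 : Nat.centralBinom (a + 1) = 2 * Nat.choose (2 * a + 1) a := by
      rw [Nat.centralBinom, show 2 * (a + 1) = (2 * a + 1) + 1 by ring, Nat.choose_succ_succ,
        Nat.choose_symm_half]
      ring
    rw [h1, h2, centralProb, h3, pow_succ, pow_mul, pow_succ]
    push_cast
    norm_num
    field_simp
    ring

/-! ### Counting subsets by the size of an intersection -/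

section Counting

variable {α : Type*} [Fintype α] [DecidableEq α]

lemma sum_finset_eq_sum_powerset_compl (B : Finset α) (F : Finset α → ℝ) :
    ∑ A, F A = ∑ A ∈ Bᶜ.powerset, ∑ C ∈ B.powerset, F (A ∪ C) := by
  rw [← Finset.sum_product']
  refine Finset.sum_nbij' (fun A => (A \ B, A ∩ B)) (fun x => x.1 ∪ x.2) ?_ ?_ ?_ ?_ ?_
  · intro A _
    simp only [Finset.mem_product, Finset.mem_powerset]
    exact ⟨fun x hx => by simp at hx ⊢; exact hx.2, Finset.inter_subset_right⟩
  · simp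
  · intro A _
    exact Finset.sdiff_union_inter A B
  · rintro ⟨A, C⟩ h
    simp only [Finset.mem_product, Finset.mem_powerset] at h
    ext x <;> have h1 := @h.1 x <;> have h2 := @h.2 x <;> simp at h1 h2 ⊢ <;> tauto
  · intro A _
    rw [Finset.sdiff_union_inter A B]

/-- The indicator that `A` contains exactly half of `S`. -/
noncomputable def halfInd (S A : Finset α) : ℝ := if 2 * (A ∩ S).card = S.card then 1 else 0

lemma sum_halfInd {S : Finset α} {r : ℕ} (hS : S.card = 2 * r) :
    ∑ A, halfInd S A = 2 ^ Fintype.card α * centralProb r := by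
  have hin : ∀ A ∈ Sᶜ.powerset, ∑ C ∈ S.powerset, halfInd S (A ∪ C) = Nat.centralBinom r := by
    intro A hA
    have hd : Disjoint A S := by
      rw [Finset.mem_powerset] at hA
      exact Finset.disjoint_left.2 fun x hx => by simpa using hA hx
    rw [Nat.centralBinom, ← hS, ← Finset.card_powersetCard, Finset.powersetCard_eq_filter,
      Finset.card_filter]
    push_cast
    refine Finset.sum_congr rfl fun C hC => ?_
    rw [halfInd, Finset.union_inter_distrib_right, Finset.disjoint_iff_inter_eq_empty.1 hd,
      Finset.empty_union, Finset.inter_eq_left.2 (Finset.mem_powerset.1 hC), hS]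
    simp
  rw [sum_finset_eq_sum_powerset_compl S, Finset.sum_congr rfl hin, Finset.sum_const,
    Finset.card_powerset, Finset.card_compl, hS, nsmul_eq_mul, centralProb]
  have hle : 2 * r ≤ Fintype.card α := hS ▸ Finset.card_le_univ S
  have h4 : (4 : ℝ) ^ r = 2 ^ (2 * r) := by rw [pow_mul]; norm_num
  rw [h4, mul_div_assoc', eq_div_iff (by positivity)]
  push_cast
  rw [mul_right_comm, ← pow_add, Nat.sub_add_cancel hle]

lemma sum_halfInd_mul_le {S T : Finset α} {r : ℕ} (hS : S.card = 2 * r) (hT : T.card = 2 * r) :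
    ∑ A, halfInd S A * halfInd T A
      ≤ 2 ^ Fintype.card α * (centralProb r * centralProb (r - (T ∩ S).card / 2)) := by
  set B := T \ S with hB
  have hcard : B.card = 2 * r - (T ∩ S).card := by
    rw [hB, Finset.card_sdiff, hT, Finset.inter_comm]
  have hcap : (T ∩ S).card ≤ 2 * r := hT ▸ Finset.card_le_card Finset.inter_subset_left
  have hSA : ∀ A, ∀ C ∈ B.powerset, halfInd S (A ∪ C) = halfInd S A := by
    intro A C hC
    have : C ∩ S = ∅ := by
      rw [← Finset.disjoint_iff_inter_eq_empty]
      exact Finset.disjoint_of_subset_left (Finset.mem_powerset.1 hC) Finset.sdiff_disjoint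
    rw [halfInd, halfInd, Finset.union_inter_distrib_right, this, Finset.union_empty]
  have hTA : ∀ A ∈ Bᶜ.powerset,
      ∑ C ∈ B.powerset, halfInd T (A ∪ C) ≤ Nat.choose B.card (B.card / 2) := by
    intro A hA
    calc ∑ C ∈ B.powerset, halfInd T (A ∪ C)
        ≤ ∑ C ∈ B.powerset, (if C.card = r - (A ∩ T).card then 1 else 0 : ℝ) := by
          refine Finset.sum_le_sum fun C hC => ?_
          rw [Finset.mem_powerset] at hA hC
          have hCT : C ∩ T = C :=
            Finset.inter_eq_left.2 (hC.trans Finset.sdiff_subset)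
          have hdis : Disjoint (A ∩ T) C :=
            Finset.disjoint_left.2 fun x hx hxC => by
              have := hA (Finset.mem_inter.1 hx).1
              rw [Finset.mem_compl] at this
              exact this (hC hxC)
          rw [halfInd, Finset.union_inter_distrib_right, hCT,
            Finset.card_union_of_disjoint hdis, hT]
          split_ifs with h1 h2 <;> first | omega | norm_num
      _ = ((Nat.choose B.card (r - (A ∩ T).card) : ℕ) : ℝ) := by
          rw [← Finset.card_powersetCard, Finset.powersetCard_eq_filter, Finset.card_filter]
          push_cast
          rfl
      _ ≤ _ := by exact_mod_cast Nat.choose_le_middle _ _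
  have hind : ∀ A, 0 ≤ halfInd S A := fun A => by unfold halfInd; split_ifs <;> norm_num
  have hprob : (Nat.choose B.card (B.card / 2) : ℝ)
      = 2 ^ B.card * centralProb (r - (T ∩ S).card / 2) := by
    have : (B.card + 1) / 2 = r - (T ∩ S).card / 2 := by omega
    rw [← this, ← choose_half_eq_centralProb]
    field_simp
  have hmarg : ∑ A, halfInd S A = (∑ A ∈ Bᶜ.powerset, halfInd S A) * 2 ^ B.card := by
    rw [sum_finset_eq_sum_powerset_compl B, Finset.sum_mul]
    refine Finset.sum_congr rfl fun A _ => ?_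
    rw [Finset.sum_congr rfl (hSA A), Finset.sum_const, Finset.card_powerset, nsmul_eq_mul,
      mul_comm]
    push_cast
    rfl
  calc ∑ A, halfInd S A * halfInd T A
      = ∑ A ∈ Bᶜ.powerset, halfInd S A * ∑ C ∈ B.powerset, halfInd T (A ∪ C) := by
        rw [sum_finset_eq_sum_powerset_compl B]
        refine Finset.sum_congr rfl fun A _ => ?_
        rw [Finset.mul_sum]
        exact Finset.sum_congr rfl fun C hC => by rw [hSA A C hC]
    _ ≤ ∑ A ∈ Bᶜ.powerset, halfInd S A * Nat.choose B.card (B.card / 2) :=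
        Finset.sum_le_sum fun A hA => mul_le_mul_of_nonneg_left (hTA A hA) (hind A)
    _ = (∑ A, halfInd S A) * centralProb (r - (T ∩ S).card / 2) := by
        rw [← Finset.sum_mul, hprob, hmarg]; ring
    _ = _ := by rw [sum_halfInd hS]; ring

end Counting

/-! ### Rademacher vectors as uniformly random subsets -/

/-- The sign vector that is `1` on `A` and `-1` off `A`. -/
noncomputable def signVec {n : ℕ} (A : Finset (Fin n)) : Fin n → ℝ :=
  fun i => if i ∈ A then 1 else -1

instance (n : ℕ) : IsProbabilityMeasure (radVec n) := by
  unfold radVec; infer_instance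

instance (m n : ℕ) : IsProbabilityMeasure (radMat m n) := by
  unfold radMat; infer_instance

lemma radVec_eq_sum_dirac (n : ℕ) :
    radVec n = ∑ A : Finset (Fin n), (2⁻¹ : ℝ≥0∞) ^ n • Measure.dirac (signVec A) := by
  refine Measure.pi_eq fun s hs => ?_
  have hrad : ∀ i, rademacherMeas (s i)
      = 2⁻¹ * (s i).indicator 1 1 + 2⁻¹ * (s i).indicator 1 (-1) := by
    intro i
    simp [rademacherMeas, Measure.dirac_apply' _ (hs i)]
  simp_rw [hrad]
  rw [Fintype.prod_add, Measure.finsetSum_apply]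
  refine Finset.sum_congr rfl fun A _ => ?_
  rw [Measure.smul_apply, Measure.dirac_apply' _ (MeasurableSet.univ_pi hs), smul_eq_mul,
    Finset.prod_mul_distrib, Finset.prod_mul_distrib, Finset.prod_const, Finset.prod_const,
    mul_mul_mul_comm, ← pow_add, Finset.card_add_card_compl, Fintype.card_fin]
  congr 1
  have hind : (Set.univ.pi s).indicator (1 : (Fin n → ℝ) → ℝ≥0∞) (signVec A)
      = ∏ i, (s i).indicator 1 (signVec A i) := by
    by_cases h : ∀ i, signVec A i ∈ s i
    · rw [Set.indicator_of_mem (by simpa using h)]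
      exact (Finset.prod_eq_one fun i _ => by rw [Set.indicator_of_mem (h i)]; rfl).symm
    · rw [Set.indicator_of_notMem (by simpa using h)]
      push Not at h
      obtain ⟨i, hi⟩ := h
      exact (Finset.prod_eq_zero (Finset.mem_univ i) (Set.indicator_of_notMem hi _)).symm
  rw [hind, ← Finset.prod_mul_prod_compl A]
  congr 1
  · exact Finset.prod_congr rfl fun i hi => by simp [signVec, hi]
  · exact Finset.prod_congr rfl fun i hi => by
      rw [Finset.mem_compl] at hi
      simp [signVec, hi]

lemma radVec_real_apply (n : ℕ) {s : Set (Fin n → ℝ)} (hs : MeasurableSet s) :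
    (radVec n).real s
      = (∑ A : Finset (Fin n), s.indicator (fun _ => (1 : ℝ)) (signVec A)) / 2 ^ n := by
  rw [measureReal_def, radVec_eq_sum_dirac, Measure.finsetSum_apply, ENNReal.toReal_sum,
    Finset.sum_div]
  · refine Finset.sum_congr rfl fun A _ => ?_
    rw [Measure.smul_apply, Measure.dirac_apply' _ hs]
    by_cases h : signVec A ∈ s <;> simp [h]
  · intro A _
    exact ENNReal.mul_ne_top (by simp) (measure_ne_top _ _)

lemma sum_signVec {n : ℕ} (S A : Finset (Fin n)) :
    ∑ i ∈ S, signVec A i = 2 * (A ∩ S).card - S.card := by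
  have h : ∀ i, signVec A i = 2 * (if i ∈ A then 1 else 0) - 1 := by
    intro i; unfold signVec; split_ifs <;> norm_num
  simp_rw [h, Finset.sum_sub_distrib, ← Finset.mul_sum]
  simp [Finset.inter_comm]

/-- Vectors whose entries on `S` sum to at most `1` in absolute value. -/
def balancedOn {n : ℕ} (S : Finset (Fin n)) : Set (Fin n → ℝ) := {w | |∑ i ∈ S, w i| ≤ 1}

lemma measurableSet_balancedOn {n : ℕ} (S : Finset (Fin n)) : MeasurableSet (balancedOn S) :=
  measurableSet_le (by fun_prop) measurable_const

lemma indicator_balancedOn_signVec {n r : ℕ} {S : Finset (Fin n)} (hS : S.card = 2 * r)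
    (A : Finset (Fin n)) :
    (balancedOn S).indicator (fun _ => (1 : ℝ)) (signVec A) = halfInd S A := by
  have key : signVec A ∈ balancedOn S ↔ 2 * (A ∩ S).card = S.card := by
    rw [balancedOn, Set.mem_ofPred_eq, sum_signVec, hS]
    have hcast : (2 * ((A ∩ S).card : ℝ) - ((2 * r : ℕ) : ℝ))
        = ((2 * ((A ∩ S).card : ℤ) - 2 * r : ℤ) : ℝ) := by push_cast; ring
    rw [hcast, ← Int.cast_abs, ← Int.cast_one, Int.cast_le, abs_le]
    omega
  unfold halfInd
  by_cases h : signVec A ∈ balancedOn S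
  · rw [Set.indicator_of_mem h, if_pos (key.1 h)]
  · rw [Set.indicator_of_notMem h, if_neg (mt key.2 h)]

lemma radVec_real_balancedOn {n r : ℕ} {S : Finset (Fin n)} (hS : S.card = 2 * r) :
    (radVec n).real (balancedOn S) = centralProb r := by
  rw [radVec_real_apply n (measurableSet_balancedOn S)]
  simp_rw [indicator_balancedOn_signVec hS]
  rw [sum_halfInd hS, Fintype.card_fin]
  field_simp

lemma radVec_real_balancedOn_inter_le {n r : ℕ} {S T : Finset (Fin n)}
    (hS : S.card = 2 * r) (hT : T.card = 2 * r) :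
    (radVec n).real (balancedOn S ∩ balancedOn T)
      ≤ centralProb r * centralProb (r - (T ∩ S).card / 2) := by
  rw [radVec_real_apply n ((measurableSet_balancedOn S).inter (measurableSet_balancedOn T))]
  have h : ∀ A, (balancedOn S ∩ balancedOn T).indicator (fun _ => (1 : ℝ)) (signVec A)
      = halfInd S A * halfInd T A := by
    intro A
    rw [← indicator_balancedOn_signVec hS, ← indicator_balancedOn_signVec hT,
      ← Set.inter_indicator_mul]
    simp
  simp_rw [h]
  rw [div_le_iff₀ (by positivity), mul_comm _ ((2 : ℝ) ^ n)]
  simpa using sum_halfInd_mul_le hS hT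

lemma FEvent_eq_pi (m n : ℕ) (S : Finset (Fin n)) :
    FEvent m n 1 S = Set.univ.pi fun _ => (balancedOn S)ᶜ := by
  ext v
  simp [FEvent, balancedOn, Set.mem_pi]

lemma measurableSet_FEvent (m n : ℕ) (S : Finset (Fin n)) : MeasurableSet (FEvent m n 1 S) := by
  rw [FEvent_eq_pi]
  exact MeasurableSet.univ_pi fun _ => (measurableSet_balancedOn S).compl

lemma radMat_real_pi (m n : ℕ) (s : Set (Fin n → ℝ)) :
    (radMat m n).real (Set.univ.pi fun _ => s) = (radVec n).real s ^ m := by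
  simp [measureReal_def, radMat, Measure.pi_pi]

lemma radMat_real_FEvent (m : ℕ) {n r : ℕ} {S : Finset (Fin n)} (hS : S.card = 2 * r) :
    (radMat m n).real (FEvent m n 1 S) = (1 - centralProb r) ^ m := by
  rw [FEvent_eq_pi, radMat_real_pi, probReal_compl_eq_one_sub (measurableSet_balancedOn S),
    radVec_real_balancedOn hS]

lemma radMat_real_FEvent_inter_le (m : ℕ) {n r : ℕ} {S T : Finset (Fin n)}
    (hS : S.card = 2 * r) (hT : T.card = 2 * r) :
    (radMat m n).real (FEvent m n 1 S ∩ FEvent m n 1 T)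
      ≤ (1 - 2 * centralProb r + centralProb r * centralProb (r - (T ∩ S).card / 2)) ^ m := by
  rw [FEvent_eq_pi, FEvent_eq_pi, ← Set.pi_inter_distrib, radMat_real_pi]
  refine pow_le_pow_left₀ measureReal_nonneg ?_ m
  rw [← Set.compl_union, probReal_compl_eq_one_sub
    ((measurableSet_balancedOn S).union (measurableSet_balancedOn T))]
  have h := measureReal_union_add_inter (μ := radVec n) (s := balancedOn S)
    (measurableSet_balancedOn T)
  rw [radVec_real_balancedOn hS, radVec_real_balancedOn hT] at h
  linarith [radVec_real_balancedOn_inter_le hS hT]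

/-! ### Second moment method -/

lemma half_le_measureReal_iUnion {Ω ι : Type*} [MeasurableSpace Ω] [Fintype ι] (μ : Measure Ω)
    [IsProbabilityMeasure μ] {F : ι → Set Ω} (hF : ∀ i, MeasurableSet (F i))
    (hpos : 0 < ∑ i, μ.real (F i))
    (hsq : ∑ i, ∑ j, μ.real (F i ∩ F j) ≤ 2 * (∑ i, μ.real (F i)) ^ 2) :
    1 / 2 ≤ μ.real (⋃ i, F i) := by
  set a := ∑ i, μ.real (F i) with ha
  set U := ⋃ i, F i with hU
  have hUm : MeasurableSet U := MeasurableSet.iUnion hF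
  let ind : Set Ω → Ω → ℝ := fun s => s.indicator fun _ => 1
  have integrable_ind : ∀ {s : Set Ω}, MeasurableSet s → Integrable (ind s) μ := fun hs =>
    (integrable_const 1).indicator hs
  have hval : ∀ {s : Set Ω}, MeasurableSet s → ∫ x, ind s x ∂μ = μ.real s := fun hs => by
    simp [ind, integral_indicator_const, hs]
  have hmul : ∀ (s t : Set Ω) (x : Ω), ind s x * ind t x = ind (s ∩ t) x := fun s t x => by
    simp [ind, ← Set.inter_indicator_mul]
  have hexp : ∀ x, ((∑ i, ind (F i) x) - 2 * a * ind U x) ^ 2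
      = (∑ i, ∑ j, ind (F i ∩ F j) x) - 4 * a * (∑ i, ind (F i) x) + 4 * a ^ 2 * ind U x := by
    intro x
    have h1 : (∑ i, ind (F i) x) * ind U x = ∑ i, ind (F i) x := by
      rw [Finset.sum_mul]
      refine Finset.sum_congr rfl fun i _ => ?_
      rw [hmul, Set.inter_eq_left.2 (Set.subset_iUnion F i)]
    have h2 : (∑ i, ind (F i) x) * (∑ i, ind (F i) x) = ∑ i, ∑ j, ind (F i ∩ F j) x := by
      rw [Finset.sum_mul_sum]
      simp_rw [hmul]
    have h3 : ind U x * ind U x = ind U x := by rw [hmul, Set.inter_self]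
    linear_combination h2 - 4 * a * h1 + 4 * a ^ 2 * h3
  have hnn : 0 ≤ ∫ x, ((∑ i, ind (F i) x) - 2 * a * ind U x) ^ 2 ∂μ :=
    integral_nonneg fun x => sq_nonneg _
  have i1 : Integrable (fun x => ∑ i, ∑ j, ind (F i ∩ F j) x) μ :=
    integrable_finsetSum _ fun i _ => integrable_finsetSum _ fun j _ => integrable_ind ((hF i).inter (hF j))
  have i2 : Integrable (fun x => ∑ i, ind (F i) x) μ :=
    integrable_finsetSum _ fun i _ => integrable_ind (hF i)
  have i3 : Integrable (fun x => (∑ i, ∑ j, ind (F i ∩ F j) x) - 4 * a * ∑ i, ind (F i) x) μ :=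
    i1.sub (i2.const_mul _)
  simp_rw [hexp] at hnn
  rw [integral_add i3 ((integrable_ind hUm).const_mul _),
    integral_sub i1 (i2.const_mul _), integral_const_mul, integral_const_mul, hval hUm,
    integral_finsetSum _ fun i _ => integrable_ind (hF i),
    integral_finsetSum _ fun i _ => integrable_finsetSum _ fun j _ =>
      integrable_ind ((hF i).inter (hF j))] at hnn
  simp_rw [hval (hF _)] at hnn
  have hpair : ∀ i, ∫ x, ∑ j, ind (F i ∩ F j) x ∂μ = ∑ j, μ.real (F i ∩ F j) := fun i => by
    rw [integral_finsetSum _ fun j _ => integrable_ind ((hF i).inter (hF j))]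
    exact Finset.sum_congr rfl fun j _ => hval ((hF i).inter (hF j))
  simp_rw [hpair] at hnn
  rw [← ha] at hnn
  have ha2 : 0 < a ^ 2 := by positivity
  nlinarith

/-! ### Transversals of a grid -/

section Transversal

variable {k b n : ℕ}

/-- The set picking, via the embedded grid `e`, the element `f i` from each row `i`. -/
def transversal (e : Fin k × Fin b ↪ Fin n) (f : Fin k → Fin b) : Finset (Fin n) :=
  Finset.univ.image fun i => e (i, f i)

lemma row_injective (e : Fin k × Fin b ↪ Fin n) (f : Fin k → Fin b) :
    Function.Injective fun i => e (i, f i) :=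
  fun _ _ h => congrArg Prod.fst (e.injective h)

lemma card_transversal (e : Fin k × Fin b ↪ Fin n) (f : Fin k → Fin b) :
    (transversal e f).card = k := by
  rw [transversal, Finset.card_image_of_injective _ (row_injective e f), Finset.card_fin]

lemma card_transversal_inter (e : Fin k × Fin b ↪ Fin n) (f g : Fin k → Fin b) :
    (transversal e g ∩ transversal e f).card = (Finset.univ.filter fun i => f i = g i).card := by
  rw [← Finset.card_image_of_injective _ (row_injective e f)]
  congr 1
  ext x
  simp only [transversal, Finset.mem_inter, Finset.mem_image, Finset.mem_univ, true_and,
    Finset.mem_filter]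
  constructor
  · rintro ⟨⟨i, rfl⟩, j, hj⟩
    have h := e.injective hj
    obtain rfl : j = i := congrArg Prod.fst h
    exact ⟨j, congrArg Prod.snd h, hj⟩
  · rintro ⟨i, hi, rfl⟩
    exact ⟨⟨i, by rw [hi]⟩, i, rfl⟩

lemma sum_pow_card_agree (f : Fin k → Fin b) (x : ℝ) :
    ∑ g : Fin k → Fin b, x ^ (Finset.univ.filter fun i => f i = g i).card
      = ((b : ℝ) - 1 + x) ^ k := by
  have h : ∀ g : Fin k → Fin b, x ^ (Finset.univ.filter fun i => f i = g i).card
      = ∏ i, if f i = g i then x else 1 := fun g => by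
    rw [Finset.prod_ite, Finset.prod_const, Finset.prod_const_one, mul_one]
  have hrow : ∀ i, ∑ y : Fin b, (if f i = y then x else 1) = (b : ℝ) - 1 + x := fun i => by
    have hsplit : ∀ y, (if f i = y then x else 1) = 1 + if f i = y then x - 1 else 0 := fun y => by
      split_ifs <;> ring
    simp_rw [hsplit, Finset.sum_add_distrib, Finset.sum_ite_eq]
    simp
    ring
  have hprod := Finset.prod_univ_sum (fun _ : Fin k => (Finset.univ : Finset (Fin b)))
    (fun i y => if f i = y then x else 1)
  rw [Fintype.piFinset_univ] at hprod
  simp_rw [h]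
  rw [← hprod]
  simp_rw [hrow]
  simp

lemma sum_pow_card_agree_le (hb : 0 < b) (f : Fin k → Fin b) {x : ℝ} (hx : 1 ≤ x) :
    ∑ g : Fin k → Fin b, x ^ (Finset.univ.filter fun i => f i = g i).card
      ≤ (b : ℝ) ^ k * Real.exp (k / b * (x - 1)) := by
  have hb' : (0 : ℝ) < b := by exact_mod_cast hb
  rw [sum_pow_card_agree, show (k / b * (x - 1) : ℝ) = k * ((x - 1) / b) by ring, Real.exp_nat_mul,
    ← mul_pow]
  refine pow_le_pow_left₀ ?_ ?_ k
  · have : (1 : ℝ) ≤ b := by exact_mod_cast hb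
    linarith
  · calc (b : ℝ) - 1 + x = b * ((x - 1) / b + 1) := by field_simp; ring
      _ ≤ _ := mul_le_mul_of_nonneg_left (Real.add_one_le_exp _) hb'.le

end Transversal

/-! ### The correlation bound -/

lemma pair_prob_le {k r m t : ℕ} (hk : k = 2 * r) (hr : 1 ≤ r)
    (hm : (m : ℝ) ≤ 1 / 100 * (k * √k)) :
    (1 - 2 * centralProb r + centralProb r * centralProb (r - t / 2)) ^ m
      ≤ ((1 - centralProb r) ^ m) ^ 2
        * (Real.exp (6 / 100 / √k) ^ t + Real.exp 5 ^ t * Real.exp (-2 * k)) := by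
  set p := centralProb r with hp
  set δ := centralProb (r - t / 2) - p with hδ
  have hp0 : 0 ≤ p := centralProb_nonneg r
  have hp1 : p ≤ 1 / 2 := centralProb_le_half hr
  have hδ0 : 0 ≤ δ := sub_nonneg.2 (centralProb_antitone (Nat.sub_le _ _))
  have hr0 : (0 : ℝ) < r := by exact_mod_cast hr
  have hkr : (k : ℝ) = 2 * r := by exact_mod_cast hk
  have hk0 : (0 : ℝ) < k := by linarith
  have hsk : 0 < √(k : ℝ) := Real.sqrt_pos.2 hk0
  have hsr : 0 < √(r : ℝ) := Real.sqrt_pos.2 hr0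
  have hmp : m * p ≤ k / 100 := by
    have h1 : p ≤ 1 / √k := (centralProb_le_inv_sqrt r).trans
      (one_div_le_one_div_of_le hsk (Real.sqrt_le_sqrt (by linarith)))
    calc m * p ≤ 1 / 100 * (k * √k) * (1 / √k) := mul_le_mul hm h1 hp0 (by positivity)
      _ = k / 100 := by field_simp
  have hbase : 1 - 2 * p + p * centralProb (r - t / 2) ≤ (1 - p) ^ 2 * Real.exp (4 * p * δ) := by
    have h1 : p * centralProb (r - t / 2) = p * δ + p ^ 2 := by rw [hδ]; ring
    have h2 : 1 / 4 ≤ (1 - p) ^ 2 := by nlinarith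
    have h3 : (1 - p) ^ 2 * (4 * p * δ + 1) ≤ (1 - p) ^ 2 * Real.exp (4 * p * δ) :=
      mul_le_mul_of_nonneg_left (Real.add_one_le_exp _) (sq_nonneg _)
    nlinarith [mul_nonneg hp0 hδ0]
  have hnn : 0 ≤ 1 - 2 * p + p * centralProb (r - t / 2) := by
    nlinarith [mul_nonneg hp0 (centralProb_nonneg (r - t / 2))]
  have hexpo : m * (4 * p * δ) ≤ k / 25 * δ := by nlinarith
  have hmain : Real.exp (k / 25 * δ)
      ≤ Real.exp (6 / 100 / √k) ^ t + Real.exp 5 ^ t * Real.exp (-2 * k) := by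
    rw [← Real.exp_nat_mul, ← Real.exp_nat_mul, ← Real.exp_add]
    by_cases ht : 2 * t ≤ k
    · refine le_trans (Real.exp_le_exp.2 ?_) (le_add_of_nonneg_right (Real.exp_pos _).le)
      have h1 : δ ≤ (t / 2 : ℕ) / (r * √r) := centralProb_sub_le hr (by omega)
      have h2 : ((t / 2 : ℕ) : ℝ) ≤ t / 2 := Nat.cast_div_le
      have h3 : √(k : ℝ) ≤ 3 / 2 * √r := by
        refine Real.sqrt_le_iff.2 ⟨by positivity, ?_⟩
        rw [mul_pow, Real.sq_sqrt hr0.le]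
        linarith
      calc k / 25 * δ ≤ k / 25 * ((t / 2) / (r * √r)) := by gcongr; exact h1.trans (by gcongr)
        _ = t / 25 * (1 / √r) := by rw [hkr]; field_simp
        _ ≤ t / 25 * ((3 / 2) / √k) := by
          gcongr t / 25 * ?_
          rw [div_le_div_iff₀ hsr hsk]
          linarith
        _ = t * (6 / 100 / √k) := by ring
    · refine le_trans (Real.exp_le_exp.2 ?_) (le_add_of_nonneg_left (Real.exp_pos _).le)
      have h1 : δ ≤ 1 := by
        have := centralProb_le_one (r - t / 2)
        linarith
      have h2 : (k : ℝ) ≤ 2 * t := by exact_mod_cast (not_le.1 ht).le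
      nlinarith
  calc _ ≤ ((1 - p) ^ 2 * Real.exp (4 * p * δ)) ^ m := pow_le_pow_left₀ hnn hbase m
    _ = ((1 - p) ^ m) ^ 2 * Real.exp (m * (4 * p * δ)) := by
        rw [mul_pow, ← Real.exp_nat_mul, ← pow_mul, ← pow_mul, mul_comm 2 m]
    _ ≤ _ := mul_le_mul_of_nonneg_left ((Real.exp_le_exp.2 hexpo).trans hmain) (by positivity)

/-- The average of the correlation bound over pairs of transversals is at most `2`. -/
lemma sum_corr_le {k b : ℕ} (hb : 0 < b) (hk : 1 ≤ k) (hkb : (k / b : ℝ) ≤ 2 * √k)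
    (hkexp : Real.exp 5 ≤ √k) (f : Fin k → Fin b) :
    ∑ g : Fin k → Fin b,
      (Real.exp (6 / 100 / √k) ^ (Finset.univ.filter fun i => f i = g i).card
        + Real.exp 5 ^ (Finset.univ.filter fun i => f i = g i).card * Real.exp (-2 * k))
      ≤ 2 * (b : ℝ) ^ k := by
  have hk0 : (1 : ℝ) ≤ k := by exact_mod_cast hk
  have hs1 : 1 ≤ √(k : ℝ) := Real.one_le_sqrt.2 hk0
  have hss : √(k : ℝ) * √k = k := Real.mul_self_sqrt (by linarith)
  set a : ℝ := 6 / 100 / √k with ha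
  have ha0 : 0 ≤ a := by positivity
  have ha_mul : a * √k = 6 / 100 := by rw [ha]; field_simp
  have ha1 : a ≤ 1 := by nlinarith
  have hea : Real.exp a - 1 ≤ 2 * a := by
    have := Real.abs_exp_sub_one_le (x := a) (by rwa [abs_of_nonneg ha0])
    rw [abs_of_nonneg ha0] at this
    exact (le_abs_self _).trans this
  have hfirst : Real.exp (k / b * (Real.exp a - 1)) ≤ 3 / 2 := by
    have h1 : (k / b : ℝ) * (Real.exp a - 1) ≤ 24 / 100 :=
      calc (k / b : ℝ) * (Real.exp a - 1) ≤ (k / b) * (2 * a) := by gcongr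
        _ ≤ 2 * √k * (2 * a) := by gcongr
        _ = 24 / 100 := by linear_combination 4 * ha_mul
    have h2 := Real.abs_exp_sub_one_le (x := (24 / 100 : ℝ)) (by norm_num [abs_of_pos])
    rw [abs_of_pos (by norm_num : (0 : ℝ) < 24 / 100)] at h2
    linarith [Real.exp_le_exp.2 h1, le_abs_self (Real.exp (24 / 100 : ℝ) - 1)]
  have he5 : 1 ≤ Real.exp 5 := Real.one_le_exp (by norm_num)
  have hsecond : Real.exp (k / b * (Real.exp 5 - 1)) * Real.exp (-2 * k) ≤ 1 / 2 := by
    rw [← Real.exp_add]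
    have h1 : k / b * (Real.exp 5 - 1) ≤ 2 * √k * (√k - 1) :=
      mul_le_mul hkb (by linarith) (by linarith) (by positivity)
    have h2 : k / b * (Real.exp 5 - 1) + -2 * k ≤ -1 := by nlinarith
    refine (Real.exp_le_exp.2 h2).trans ?_
    rw [Real.exp_neg, ← one_div]
    exact one_div_le_one_div_of_le (by norm_num) (by linarith [Real.add_one_le_exp (1 : ℝ)])
  have hbk : (0 : ℝ) ≤ (b : ℝ) ^ k := by positivity
  rw [Finset.sum_add_distrib, ← Finset.sum_mul]
  calc _ ≤ (b : ℝ) ^ k * Real.exp (k / b * (Real.exp a - 1))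
        + (b : ℝ) ^ k * Real.exp (k / b * (Real.exp 5 - 1)) * Real.exp (-2 * k) := by
        gcongr
        · exact sum_pow_card_agree_le hb f (Real.one_le_exp ha0)
        · exact sum_pow_card_agree_le hb f he5
    _ ≤ (b : ℝ) ^ k * (3 / 2) + (b : ℝ) ^ k * (1 / 2) := by
        rw [mul_assoc]
        gcongr
    _ = 2 * (b : ℝ) ^ k := by ring

lemma radMat_real_iUnion_transversal {k r b n m : ℕ} (hk : k = 2 * r) (hr : 1 ≤ r) (hb : 0 < b)
    (hm : (m : ℝ) ≤ 1 / 100 * (k * √k)) (hkb : (k / b : ℝ) ≤ 2 * √k)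
    (hkexp : Real.exp 5 ≤ √k) (e : Fin k × Fin b ↪ Fin n) :
    1 / 2 ≤ (radMat m n).real (⋃ f : Fin k → Fin b, FEvent m n 1 (transversal e f)) := by
  have hcard : ∀ f, (transversal e f).card = 2 * r := fun f => (card_transversal e f).trans hk
  set q := (1 - centralProb r) ^ m with hq
  have hq0 : 0 < q := pow_pos (by linarith [centralProb_le_half hr]) m
  have hb' : (0 : ℝ) < b := by exact_mod_cast hb
  have hmean : ∑ f : Fin k → Fin b, (radMat m n).real (FEvent m n 1 (transversal e f))
      = (b : ℝ) ^ k * q := by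
    simp_rw [radMat_real_FEvent m (hcard _)]
    simp
    exact Or.inl hq.symm
  refine half_le_measureReal_iUnion _ (fun f => measurableSet_FEvent m n _) ?_ ?_
  · rw [hmean]; positivity
  · rw [hmean]
    calc _ ≤ ∑ f : Fin k → Fin b, q ^ 2 * (2 * (b : ℝ) ^ k) := by
          refine Finset.sum_le_sum fun f _ => ?_
          refine le_trans ?_
            (mul_le_mul_of_nonneg_left (sum_corr_le hb (by omega) hkb hkexp f) (sq_nonneg q))
          rw [Finset.mul_sum]
          refine Finset.sum_le_sum fun g _ => ?_
          refine (radMat_real_FEvent_inter_le m (hcard f) (hcard g)).trans ?_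
          rw [card_transversal_inter]
          exact pair_prob_le hk hr hm
      _ = 2 * ((b : ℝ) ^ k * q) ^ 2 := by
          simp
          ring

/-- with `m ≤ c·k^{1.5}` i.i.d. Rademacher vectors (`k` even and large),
the resulting set fails to be `(n, k, 1)`-balanced with probability at least `1/2`. -/
theorem rademacher_balancing_lower_bound (ε : ℝ) (hε1 : 0 < ε) (hε2 : ε < 2/3) :
    ∃ c : ℝ, 0 < c ∧ ∃ K : ℕ, ∀ k n m : ℕ, Even k → K ≤ k →
      (k : ℝ) ≤ (n : ℝ) ^ ((2:ℝ)/3 - ε) →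
      (m : ℝ) ≤ c * (k : ℝ) ^ (1.5:ℝ) →
      radMat m n {v | ¬ IsBalanced n k 1 (Set.range v)} ≥ 1/2 := by
  obtain ⟨K, hK⟩ := exists_nat_ge (Real.exp 5 ^ 2)
  refine ⟨1 / 100, by norm_num, K, fun k n m hev hKk hkn hm => ?_⟩
  have hkK : Real.exp 5 ^ 2 ≤ k := hK.trans (by exact_mod_cast hKk)
  have hkexp : Real.exp 5 ≤ √k := Real.le_sqrt_of_sq_le hkK
  have hk0 : (0 : ℝ) < k := lt_of_lt_of_le (by positivity) hkK
  have hk1 : 1 ≤ k := by exact_mod_cast hk0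
  obtain ⟨r, hkr⟩ := hev.two_dvd
  have hpow : (k : ℝ) ^ (1.5 : ℝ) = k * √k := by
    rw [show (1.5 : ℝ) = 1 + 1 / 2 by norm_num, Real.rpow_add hk0, Real.rpow_one,
      Real.sqrt_eq_rpow]
  rw [hpow] at hm
  have hn1 : 1 ≤ n := by
    rcases Nat.eq_zero_or_pos n with rfl | h
    · rw [Nat.cast_zero, Real.zero_rpow (by linarith)] at hkn
      linarith
    · exact h
  have hn1' : (1 : ℝ) ≤ n := by exact_mod_cast hn1
  have hkn' : k * √k ≤ n := by
    rw [← hpow]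
    calc (k : ℝ) ^ (1.5 : ℝ) ≤ ((n : ℝ) ^ ((2 : ℝ) / 3 - ε)) ^ (1.5 : ℝ) := by gcongr
      _ = (n : ℝ) ^ (((2 : ℝ) / 3 - ε) * 1.5) := by rw [← Real.rpow_mul (by linarith)]
      _ ≤ (n : ℝ) ^ (1 : ℝ) := Real.rpow_le_rpow_of_exponent_le hn1' (by linarith)
      _ = n := Real.rpow_one _
  have hs1 : 1 ≤ √(k : ℝ) := Real.one_le_sqrt.2 (by exact_mod_cast hk1)
  have hkle : k ≤ n := by
    have : (k : ℝ) ≤ n := by nlinarith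
    exact_mod_cast this
  have hb : 0 < n / k := Nat.div_pos hkle hk1
  have hb' : (0 : ℝ) < (n / k : ℕ) := by exact_mod_cast hb
  have hkb : (k / (n / k : ℕ) : ℝ) ≤ 2 * √k := by
    have h1 : n ≤ 2 * (k * (n / k)) := by
      have h2 := Nat.div_add_mod n k
      have h3 := Nat.mod_lt n hk1
      nlinarith
    have h1' : (n : ℝ) ≤ 2 * (k * (n / k : ℕ)) := by exact_mod_cast h1
    rw [div_le_iff₀ hb']
    have h4 : √(k : ℝ) * √k = k := Real.mul_self_sqrt hk0.le
    have h5 : √(k : ℝ) ≤ 2 * (n / k : ℕ) := by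
      have : k * √k ≤ k * (2 * (n / k : ℕ)) := by linarith
      exact le_of_mul_le_mul_left this hk0
    nlinarith
  obtain ⟨e⟩ : Nonempty (Fin k × Fin (n / k) ↪ Fin n) :=
    Function.Embedding.nonempty_of_card_le (by simpa using Nat.mul_div_le n k)
  have hU := radMat_real_iUnion_transversal hkr (by omega) hb hm hkb hkexp e
  have hsub : (⋃ f : Fin k → Fin (n / k), FEvent m n 1 (transversal e f))
      ⊆ {v | ¬ IsBalanced n k 1 (Set.range v)} := by
    refine Set.iUnion_subset fun f v hv hbal => ?_
    obtain ⟨_, ⟨j, rfl⟩, hj⟩ := hbal _ (card_transversal e f)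
    exact absurd hj (not_le.2 (hv j))
  refine le_trans ?_ (measure_mono hsub)
  rw [measureReal_def] at hU
  rw [show (1 / 2 : ℝ≥0∞) = ENNReal.ofReal (1 / 2) by
    rw [ENNReal.ofReal_div_of_pos (by norm_num)]; simp]
  exact ENNReal.ofReal_le_of_le_toReal hU
end

section
/- Let k be an even positive integer and let d be an integer with 0 ≤ d < k. Then Σ_{i=0}^{d} C(d, i)·2^(−d) · ( C(k − d, k/2 − i)·2^(−(k−d)) )² ≤ 2/(π·(k − d)), where C(a, b) denotes the binomial coefficient (with C(a, b) = 0 when b < 0 or b > a). Equivalently, if v is a uniformly random vector in {−1,+1}^n and S, T ⊆ {1,…,n} satisfy |S| = |T| = k and |S ∩ T| = d, then P[ Σ_{i∈S} v_i = 0 and Σ_{i∈T} v_i = 0 ] ≤ 2/(π·(k − d)). -/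
open MeasureTheory ProbabilityTheory
open scoped NNReal ENNReal

/-- Wallis' bound on the central binomial coefficient. -/
lemma centralBinom_div_four_pow_sq_le (p : ℕ) (hp : 0 < p) :
    ((p.centralBinom : ℝ) / 4 ^ p) ^ 2 ≤ 1 / (Real.pi * p) := by
  have hW := Real.Wallis.le_W p
  rw [Real.Wallis.W_eq_factorial_ratio] at hW
  have hc : (p.centralBinom : ℝ) * ((p.factorial : ℝ) * p.factorial) = (2 * p).factorial := by
    have h := Nat.choose_mul_factorial_mul_factorial (show p ≤ 2 * p by omega)
    rw [show 2 * p - p = p by omega] at h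
    rw [Nat.centralBinom, ← h]
    push_cast
    ring
  rw [← hc] at hW
  have hcb : (0 : ℝ) < p.centralBinom := by exact_mod_cast p.centralBinom_pos
  have hf : (0 : ℝ) < p.factorial := by exact_mod_cast p.factorial_pos
  have hp' : (0 : ℝ) < p := by exact_mod_cast hp
  have hpow : (2 : ℝ) ^ (4 * p) = (4 ^ p) ^ 2 := by
    rw [← pow_mul, mul_comm p 2, pow_mul, pow_mul]
    norm_num
  rw [hpow] at hW
  have h4 : (0 : ℝ) < 4 ^ p := by positivity
  rw [div_pow, div_le_div_iff₀ (by positivity) (by positivity)]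
  have hW' : (2 * (p : ℝ) + 1) / (2 * p + 2) * (Real.pi / 2) ≤
      (4 ^ p) ^ 2 / ((p.centralBinom : ℝ) ^ 2 * (2 * p + 1)) := by
    refine hW.trans_eq ?_
    field_simp
  rw [le_div_iff₀ (by positivity)] at hW'
  have hpi := Real.pi_pos
  have hcmp : Real.pi * p ≤
      (2 * (p : ℝ) + 1) / (2 * p + 2) * (Real.pi / 2) * (2 * p + 1) := by
    rw [div_mul_eq_mul_div, div_mul_eq_mul_div, le_div_iff₀ (by positivity)]
    nlinarith
  nlinarith [mul_le_mul_of_nonneg_left hcmp (sq_nonneg (p.centralBinom : ℝ))]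

lemma choose_div_two_pow_sq_le (m j : ℕ) (hm : 0 < m) :
    ((m.choose j : ℝ) / 2 ^ m) ^ 2 ≤ 2 / (Real.pi * m) := by
  have hpi := Real.pi_pos
  have hm' : (0 : ℝ) < m := by exact_mod_cast hm
  have hmono : ((m.choose j : ℝ) / 2 ^ m) ^ 2 ≤ ((m.choose (m / 2) : ℝ) / 2 ^ m) ^ 2 := by
    gcongr
    exact Nat.choose_le_middle j m
  refine hmono.trans ?_
  obtain ⟨p, rfl | rfl⟩ := Nat.even_or_odd' m
  · rw [show 2 * p / 2 = p by omega, pow_mul]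
    have h := centralBinom_div_four_pow_sq_le p (by omega)
    norm_num [Nat.centralBinom] at h ⊢
    refine h.trans_eq ?_
    field_simp
  · rw [show (2 * p + 1) / 2 = p by omega]
    have h := centralBinom_div_four_pow_sq_le (p + 1) (by omega)
    have hc : ((p + 1).centralBinom : ℝ) = 2 * ((2 * p + 1).choose p : ℝ) := by
      have : (p + 1).centralBinom = 2 * (2 * p + 1).choose p := by
        rw [Nat.centralBinom, show 2 * (p + 1) = (2 * p + 1) + 1 by ring, Nat.choose_succ_succ,
          Nat.choose_symm_half]
        ring
      exact_mod_cast this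
    have hr : ((2 * p + 1).choose p : ℝ) / 2 ^ (2 * p + 1)
        = ((p + 1).centralBinom : ℝ) / 4 ^ (p + 1) := by
      rw [hc, pow_succ, pow_mul, pow_succ, div_eq_div_iff (by positivity) (by positivity)]
      norm_num
      ring
    rw [hr]
    refine h.trans ?_
    rw [div_le_div_iff₀ (by positivity) (by positivity)]
    push_cast
    nlinarith

lemma measure_eq_comp_and_mem_le {Ω β : Type*} [MeasurableSpace Ω] [MeasurableSpace β]
    {μ : Measure Ω} [IsProbabilityMeasure μ] {X : Ω → ℝ} {W : Ω → β}
    (hX : Measurable X) (hW : Measurable W) (hXW : IndepFun X W μ) {c : ℝ≥0∞}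
    (hc : ∀ x, μ {ω | X ω = x} ≤ c) {f : β → ℝ} (hf : Measurable f) {E : Set β}
    (hE : MeasurableSet E) :
    μ {ω | X ω = f (W ω) ∧ W ω ∈ E} ≤ c * μ {ω | W ω ∈ E} := by
  have := Measure.isProbabilityMeasure_map (μ := μ) hX.aemeasurable
  have := Measure.isProbabilityMeasure_map (μ := μ) hW.aemeasurable
  have hQ : MeasurableSet {p : ℝ × β | p.1 = f p.2 ∧ p.2 ∈ E} :=
    (measurableSet_eq_fun measurable_fst (hf.comp measurable_snd)).inter (measurable_snd hE)
  have hprod := (indepFun_iff_map_prod_eq_prod_map_map hX.aemeasurable hW.aemeasurable).1 hXW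
  have hmap : μ {ω | X ω = f (W ω) ∧ W ω ∈ E} =
      μ.map (fun ω => (X ω, W ω)) {p : ℝ × β | p.1 = f p.2 ∧ p.2 ∈ E} := by
    rw [Measure.map_apply (hX.prodMk hW) hQ]
    rfl
  rw [hmap, hprod, Measure.prod_apply_symm hQ]
  calc ∫⁻ w, μ.map X ((fun x => (x, w)) ⁻¹' {p : ℝ × β | p.1 = f p.2 ∧ p.2 ∈ E}) ∂μ.map W
      ≤ ∫⁻ w, E.indicator (fun _ => c) w ∂μ.map W := by
        refine lintegral_mono fun w => ?_
        by_cases hw : w ∈ E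
        · simp only [Set.preimage_ofPred_eq, hw, and_true, Set.indicator_of_mem]
          rw [Set.ofPred_eq_eq_singleton, Measure.map_apply hX (measurableSet_singleton (f w))]
          exact hc _
        · simp [hw]
    _ = c * μ {ω | W ω ∈ E} := by
        rw [lintegral_indicator_const hE, Measure.map_apply hW hE]
        rfl

instance inst_s18 (n : ℕ) : IsProbabilityMeasure (radVec n) := by
  unfold radVec
  infer_instance

lemma iIndepFun_radVec (n : ℕ) : iIndepFun (fun i (v : Fin n → ℝ) => v i) (radVec n) :=
  iIndepFun_pi (X := fun _ => id) fun _ => aemeasurable_id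

lemma radVec_map_eval (n : ℕ) (i : Fin n) :
    (radVec n).map (fun v => v i) = rademacherMeas :=
  (measurePreserving_eval (fun _ : Fin n => rademacherMeas) i).map_eq

lemma measurable_coord_sum {n : ℕ} (A : Finset (Fin n)) :
    Measurable fun v : Fin n → ℝ => ∑ i ∈ A, v i := by
  fun_prop

lemma radVec_sum_insert {n : ℕ} {A : Finset (Fin n)} {a : Fin n} (ha : a ∉ A) (x : ℝ) :
    radVec n {v | ∑ i ∈ insert a A, v i = x} =
      2⁻¹ * radVec n {v | ∑ i ∈ A, v i = x - 1} +
        2⁻¹ * radVec n {v | ∑ i ∈ A, v i = x + 1} := by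
  have hind : IndepFun (fun v : Fin n → ℝ => ∑ i ∈ A, v i) (fun v => v a) (radVec n) := by
    have h := (iIndepFun_radVec n).indepFun_finsetSum_of_notMem
      (fun i => measurable_pi_apply i) ha
    convert h using 1
    ext v
    simp
  have hS := measurable_coord_sum A
  have hprod := (indepFun_iff_map_prod_eq_prod_map_map hS.aemeasurable
    (measurable_pi_apply a).aemeasurable).1 hind
  have hQ : MeasurableSet {p : ℝ × ℝ | p.2 + p.1 = x} :=
    measurableSet_eq_fun (by fun_prop) measurable_const
  have := Measure.isProbabilityMeasure_map (μ := radVec n) hS.aemeasurable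
  have hmap : radVec n {v | ∑ i ∈ insert a A, v i = x} =
      (radVec n).map (fun v => (∑ i ∈ A, v i, v a)) {p : ℝ × ℝ | p.2 + p.1 = x} := by
    rw [Measure.map_apply (by fun_prop) hQ]
    simp [Finset.sum_insert ha]
  rw [hmap, hprod, radVec_map_eval, Measure.prod_apply_symm hQ, rademacherMeas,
    lintegral_add_measure, lintegral_smul_measure, lintegral_smul_measure, lintegral_dirac,
    lintegral_dirac]
  have hone (y : ℝ) : 1 + y = x ↔ y = x - 1 := by constructor <;> intro h <;> linarith
  have hneg (y : ℝ) : -1 + y = x ↔ y = x + 1 := by constructor <;> intro h <;> linarith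
  simp only [smul_eq_mul, Set.preimage_ofPred_eq]
  rw [Measure.map_apply hS (measurableSet_eq_fun (by fun_prop) measurable_const),
    Measure.map_apply hS (measurableSet_eq_fun (by fun_prop) measurable_const)]
  simp only [Set.preimage_ofPred_eq]
  simp only [hone, hneg]

/-- The sum of `m` Rademacher variables takes the values `m - 2j` with binomial probabilities. -/
lemma radVec_sum_eq {n : ℕ} (A : Finset (Fin n)) :
    (∀ j : ℕ, radVec n {v | ∑ i ∈ A, v i = (A.card : ℝ) - 2 * j} =
        (A.card.choose j : ℝ≥0∞) * 2⁻¹ ^ A.card) ∧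
      ∀ x : ℝ, (∀ j : ℕ, x ≠ (A.card : ℝ) - 2 * j) → radVec n {v | ∑ i ∈ A, v i = x} = 0 := by
  induction A using Finset.induction_on with
  | empty =>
    refine ⟨fun j => ?_, fun x hx => ?_⟩
    · cases j with
      | zero => simp
      | succ j =>
        have : (0 : ℝ) ≠ -(2 * ((j : ℝ) + 1)) := by
          have : (0 : ℝ) ≤ j := j.cast_nonneg
          linarith
        simp [this]
    · have := hx 0
      simp at this
      simp [Ne.symm this]
  | insert a A ha ih =>
    obtain ⟨ih, ih_zero⟩ := ih
    simp only [radVec_sum_insert ha, Finset.card_insert_of_notMem ha, Nat.cast_add, Nat.cast_one]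
    refine ⟨fun j => ?_, fun x hx => ?_⟩
    · rw [show (A.card : ℝ) + 1 - 2 * j - 1 = A.card - 2 * j by ring, ih]
      cases j with
      | zero =>
        rw [ih_zero]
        · simp [pow_succ, mul_comm]
        · intro j h
          have : (0 : ℝ) ≤ j := j.cast_nonneg
          push_cast at h
          linarith
      | succ j =>
        rw [show (A.card : ℝ) + 1 - 2 * (j + 1 : ℕ) + 1 = A.card - 2 * j by push_cast; ring, ih,
          Nat.choose_succ_succ]
        push_cast
        ring
    · rw [ih_zero, ih_zero]
      · simp
      · intro j h
        refine hx (j + 1) ?_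
        push_cast
        linarith
      · intro j h
        exact hx j (by linarith)

lemma radVec_sum_eq_le {n : ℕ} (A : Finset (Fin n)) {m : ℕ} (hm : 0 < m) (hmA : m ≤ A.card)
    (x : ℝ) :
    radVec n {v | ∑ i ∈ A, v i = x} ≤ ENNReal.ofReal (√(2 / (Real.pi * m))) := by
  by_cases hx : ∀ j : ℕ, x ≠ (A.card : ℝ) - 2 * j
  · rw [(radVec_sum_eq A).2 x hx]
    exact zero_le
  · push Not at hx
    obtain ⟨j, rfl⟩ := hx
    have hcast : (A.card.choose j : ℝ≥0∞) * 2⁻¹ ^ A.card =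
        ENNReal.ofReal ((A.card.choose j : ℝ) / 2 ^ A.card) := by
      rw [div_eq_mul_inv, ENNReal.ofReal_mul (by positivity), ENNReal.ofReal_natCast,
        ← inv_pow, ENNReal.ofReal_pow (by norm_num), ENNReal.ofReal_inv_of_pos (by norm_num)]
      simp
    rw [(radVec_sum_eq A).1 j, hcast]
    refine ENNReal.ofReal_le_ofReal (Real.le_sqrt_of_sq_le ?_)
    refine (choose_div_two_pow_sq_le A.card j (by omega)).trans ?_
    have := Real.pi_pos
    have : (0 : ℝ) < m := by exact_mod_cast hm
    gcongr

lemma radVec_sum_eq_zero_and_le {n m : ℕ} (S T : Finset (Fin n)) (hm : 0 < m)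
    (hS : m ≤ (S \ T).card) (hT : m ≤ T.card) :
    radVec n {v | (∑ i ∈ S, v i) = 0 ∧ (∑ i ∈ T, v i) = 0} ≤
      ENNReal.ofReal (2 / (Real.pi * m)) := by
  let W : (Fin n → ℝ) → T → ℝ := fun v i => v i
  have hW : Measurable W := by fun_prop
  let f : (T → ℝ) → ℝ := fun w => -∑ i : T with i.1 ∈ S, w i
  have hf : Measurable f := by fun_prop
  have hE : MeasurableSet {w : T → ℝ | ∑ i, w i = 0} :=
    measurableSet_eq_fun (by fun_prop) measurable_const
  have hind : IndepFun (fun v : Fin n → ℝ => ∑ i ∈ S \ T, v i) W (radVec n) := by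
    have h := (iIndepFun_radVec n).indepFun_finset (S \ T) T Finset.sdiff_disjoint
      (fun i => measurable_pi_apply i)
    have h' := h.comp (φ := fun w : ↥(S \ T) → ℝ => ∑ i, w i) (ψ := id) (by fun_prop)
      measurable_id
    have hsum : (fun v : Fin n → ℝ => ∑ i ∈ S \ T, v i) =
        (fun w : ↥(S \ T) → ℝ => ∑ i, w i) ∘ fun v i => v i := by
      ext v
      exact (Finset.sum_coe_sort (S \ T) v).symm
    rw [hsum]
    exact h'
  have key := measure_eq_comp_and_mem_le (measurable_coord_sum (S \ T)) hW hind
    (radVec_sum_eq_le (S \ T) hm hS) hf hE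
  have hWT (v : Fin n → ℝ) : ∑ i, W v i = ∑ i ∈ T, v i := Finset.sum_coe_sort T v
  have hfW (v : Fin n → ℝ) : f (W v) = -∑ i ∈ S ∩ T, v i := by
    simp only [f, W]
    rw [Finset.sum_filter, Finset.sum_coe_sort T (fun i => if i ∈ S then v i else 0),
      ← Finset.sum_filter, Finset.filter_mem_eq_inter, Finset.inter_comm]
  have hevent : {v : Fin n → ℝ | (∑ i ∈ S, v i) = 0 ∧ (∑ i ∈ T, v i) = 0} =
      {v | ∑ i ∈ S \ T, v i = f (W v) ∧ W v ∈ {w : T → ℝ | ∑ i, w i = 0}} := by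
    ext v
    simp only [Set.mem_ofPred_eq, hWT, hfW]
    rw [← Finset.sum_inter_add_sum_sdiff S T v, eq_neg_iff_add_eq_zero, add_comm]
  rw [hevent]
  refine key.trans ?_
  simp only [Set.mem_ofPred_eq, hWT]
  refine (mul_le_mul_right (radVec_sum_eq_le T hm hT 0) _).trans_eq ?_
  have := Real.pi_pos
  rw [← ENNReal.ofReal_mul (by positivity), Real.mul_self_sqrt (by positivity)]

/-- for even `k` and `0 ≤ d < k`,
`Σ_{i=0}^{d} C(d,i)·2^{−d}·(C(k−d, k/2−i)·2^{−(k−d)})² ≤ 2/(π(k−d))`; equivalently, two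
size-`k` sets `S, T` with `|S ∩ T| = d` are simultaneously balanced to zero by a random
Rademacher vector with probability at most `2/(π(k−d))`. -/
theorem rademacher_joint_zero_prob (k d : ℕ) (hk : 0 < k) (hke : Even k) (hd : d < k)
    (n : ℕ) (S T : Finset (Fin n)) (hS : S.card = k) (hT : T.card = k)
    (hST : (S ∩ T).card = d) :
    (∑ i ∈ Finset.range (d + 1),
        (d.choose i : ℝ) * (2:ℝ) ^ (-(d:ℝ)) *
          ((if i ≤ k / 2 then ((k - d).choose (k / 2 - i) : ℝ) else 0) *
            (2:ℝ) ^ (-((k:ℝ) - (d:ℝ)))) ^ 2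
      ≤ 2 / (Real.pi * ((k:ℝ) - (d:ℝ)))) ∧
    radVec n {v | (∑ i ∈ S, v i) = 0 ∧ (∑ i ∈ T, v i) = 0} ≤
      ENNReal.ofReal (2 / (Real.pi * ((k:ℝ) - (d:ℝ)))) := by
  have hm : 0 < k - d := by omega
  have hcast : ((k - d : ℕ) : ℝ) = (k : ℝ) - d := Nat.cast_sub hd.le
  constructor
  · rw [← hcast]
    have hpi := Real.pi_pos
    calc _ ≤ ∑ i ∈ Finset.range (d + 1),
          (d.choose i : ℝ) * (2:ℝ) ^ (-(d:ℝ)) * (2 / (Real.pi * ((k - d : ℕ) : ℝ))) := by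
          refine Finset.sum_le_sum fun i _ => ?_
          refine mul_le_mul_of_nonneg_left ?_ (by positivity)
          rw [Real.rpow_neg (by norm_num), Real.rpow_natCast, ← div_eq_mul_inv]
          split_ifs
          · exact choose_div_two_pow_sq_le _ _ hm
          · rw [zero_div, zero_pow two_ne_zero]
            positivity
      _ = 2 / (Real.pi * ((k - d : ℕ) : ℝ)) := by
          rw [← Finset.sum_mul, ← Finset.sum_mul, ← Nat.cast_sum, Nat.sum_range_choose,
            Real.rpow_neg (by norm_num), Real.rpow_natCast]
          push_cast
          rw [mul_inv_cancel₀ (by positivity), one_mul]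
  · rw [← hcast]
    refine radVec_sum_eq_zero_and_le S T hm ?_ (by omega)
    have := Finset.card_sdiff_add_card_inter S T
    omega
end

section
/- For every positive integer m and every matrix A ∈ {−1, +1}^(m×3), A is not a valid universal 1-bit measurement matrix for support recovery on X_2(2) in ℝ³. In particular, for the vectors x₁ = (2, 1, 0) and x₂ = (2, 0, 1), which both lie in X_2(2) and have different supports, sign(A·x₁) = sign(A·x₂) for every A ∈ {−1, +1}^(m×3), since sign(2b₁ + b₂) = sign(2b₁ + b₃) for every (b₁, b₂, b₃) ∈ {−1, +1}³. -/
open MeasureTheory ProbabilityTheory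
open scoped NNReal ENNReal

/-- For `a, b, c ∈ {−1, +1}`, the sign of `2a + b` depends only on `a`. -/
theorem sgn_two_mul_add_eq {a b c : ℝ} (ha : a = 1 ∨ a = -1) (hb : b = 1 ∨ b = -1)
    (hc : c = 1 ∨ c = -1) : sgn (2 * a + b) = sgn (2 * a + c) := by
  rcases ha with rfl | rfl <;> rcases hb with rfl | rfl <;> rcases hc with rfl | rfl <;>
    norm_num [sgn]

theorem two_one_zero_mem_sparseDR : (![2, 1, 0] : Fin 3 → ℝ) ∈ sparseDR 3 2 2 := by
  refine ⟨?_, fun i j => ?_⟩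
  · simp [Finset.card_filter, Fin.sum_univ_three]
  · fin_cases i <;> fin_cases j <;> norm_num

theorem two_zero_one_mem_sparseDR : (![2, 0, 1] : Fin 3 → ℝ) ∈ sparseDR 3 2 2 := by
  refine ⟨?_, fun i j => ?_⟩
  · simp [Finset.card_filter, Fin.sum_univ_three]
  · fin_cases i <;> fin_cases j <;> norm_num

theorem support_two_one_zero_ne :
    Function.support (![2, 1, 0] : Fin 3 → ℝ) ≠ Function.support (![2, 0, 1] : Fin 3 → ℝ) := by
  intro h
  have h1 : (1 : Fin 3) ∈ Function.support (![2, 1, 0] : Fin 3 → ℝ) := by simp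
  rw [h] at h1
  simp at h1

/-- no `±1`-valued matrix is a valid universal 1-bit measurement matrix for
support recovery on `X_2(2)` in `ℝ³`: the vectors `x₁ = (2,1,0)` and `x₂ = (2,0,1)` lie in
`X_2(2)`, have different supports, yet `sign(A x₁) = sign(A x₂)`, since
`sign(2b₁ + b₂) = sign(2b₁ + b₃)` for every `(b₁,b₂,b₃) ∈ {−1,+1}³`. -/
theorem rademacher_fails_R2 (m : ℕ) (hm : 0 < m) (A : Fin m → Fin 3 → ℝ)
    (hpm : ∀ i j, A i j = 1 ∨ A i j = -1) :
    ¬ ValidMeas m 3 2 2 A ∧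
    (![2, 1, 0] : Fin 3 → ℝ) ∈ sparseDR 3 2 2 ∧
    (![2, 0, 1] : Fin 3 → ℝ) ∈ sparseDR 3 2 2 ∧
    Function.support (![2, 1, 0] : Fin 3 → ℝ) ≠ Function.support (![2, 0, 1] : Fin 3 → ℝ) ∧
    (fun i => sgn (∑ j, A i j * (![2, 1, 0] : Fin 3 → ℝ) j)) =
      (fun i => sgn (∑ j, A i j * (![2, 0, 1] : Fin 3 → ℝ) j)) ∧
    ∀ b : Fin 3 → ℝ, (∀ j, b j = 1 ∨ b j = -1) →
      sgn (2 * b 0 + b 1) = sgn (2 * b 0 + b 2) := by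
  have hsgn : (fun i => sgn (∑ j, A i j * (![2, 1, 0] : Fin 3 → ℝ) j)) =
      (fun i => sgn (∑ j, A i j * (![2, 0, 1] : Fin 3 → ℝ) j)) := by
    funext i
    simpa [Fin.sum_univ_three, mul_comm] using
      sgn_two_mul_add_eq (hpm i 0) (hpm i 1) (hpm i 2)
  exact ⟨fun hA => hA _ two_one_zero_mem_sparseDR _ two_zero_one_mem_sparseDR
      support_two_one_zero_ne hsgn,
    two_one_zero_mem_sparseDR, two_zero_one_mem_sparseDR, support_two_one_zero_ne, hsgn,
    fun b hb => sgn_two_mul_add_eq (hb 0) (hb 1) (hb 2)⟩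
end
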